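/- arXiv:2303.12716 — 3 statements merged into one kernel-verified Lean document; each statement's English description precedes it below -/
import Mathlib

section
/- The largest element of the spectrum 𝕃₂ is 4/√5. Moreover, for an irrational number α one has 𝔨(α) = 4/√5 if and only if α is equivalent to the golden ratio (1+√5)/2 = [1; 1, 1, 1, …]. -/
open Filter

/-- The tails `αₙ = [aₙ; aₙ₊₁, …]` of the continued fraction of `α`. -/
noncomputable def cfTail (α : ℝ) : ℕ → ℝ
  | 0 => α
  | n + 1 => (Int.fract (cfTail α n))⁻¹

/-- The partial quotients `aₙ` of the continued fraction of `α`. -/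
noncomputable def cfDigit (α : ℝ) (n : ℕ) : ℤ := ⌊cfTail α n⌋

/-- Value `[a; b, c, …]` of a finite continued fraction given by a list. -/
noncomputable def finCF : List ℤ → ℝ
  | [] => 0
  | a :: l => (a : ℝ) + (finCF l)⁻¹

/-- `α*ₙ = [0; aₙ, aₙ₋₁, …, a₁]`. -/
noncomputable def cfStar (α : ℝ) (n : ℕ) : ℝ :=
  (finCF (((List.range' 1 n).reverse).map (cfDigit α)))⁻¹

/-- Numerators `pₙ` of the convergents of `α`. -/
noncomputable def cfNum (α : ℝ) : ℕ → ℤ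
  | 0 => cfDigit α 0
  | 1 => cfDigit α 1 * cfDigit α 0 + 1
  | n + 2 => cfDigit α (n + 2) * cfNum α (n + 1) + cfNum α n

/-- Denominators `qₙ` of the convergents of `α`. -/
noncomputable def cfDen (α : ℝ) : ℕ → ℤ
  | 0 => 1
  | 1 => cfDigit α 1
  | n + 2 => cfDigit α (n + 2) * cfDen α (n + 1) + cfDen α n

/-- The irrationality measure function `ψ_α^[2]` for "second best" approximations. -/
noncomputable def psi2 (α : ℝ) (t : ℝ) : ℝ :=
  sInf { x : ℝ | ∃ p q : ℤ, 1 ≤ q ∧ (q : ℝ) ≤ t ∧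
    (∀ n : ℕ, (p, q) ≠ (cfNum α n, cfDen α n)) ∧ x = |(q : ℝ) * α - (p : ℝ)| }

/-- The Diophantine constant `𝔨(α) = liminf_{t → ∞} t · ψ_α^[2](t)`. -/
noncomputable def kConst (α : ℝ) : ℝ := liminf (fun t : ℝ => t * psi2 α t) atTop

/-- Two numbers are equivalent if the tails of their continued fraction expansions
coincide: `a_{n+k} = b_{m+k}` for all `k ≥ 1`, for some positive integers `m`, `n`. -/
def CFEquiv (α β : ℝ) : Prop :=
  ∃ n m : ℕ, 0 < n ∧ 0 < m ∧ ∀ k : ℕ, 0 < k → cfDigit α (n + k) = cfDigit β (m + k)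

/-- The spectrum `𝕃₂` of values of `𝔨`. -/
def L2 : Set ℝ := { l : ℝ | ∃ α : ℝ, Irrational α ∧ l = kConst α }

/-- `κ¹ₙ(α) = (1 + α*ₙ₋₁)(αₙ − 1)/(αₙ + α*ₙ₋₁)`. -/
noncomputable def kappa1 (α : ℝ) (n : ℕ) : ℝ :=
  (1 + cfStar α (n - 1)) * (cfTail α n - 1) / (cfTail α n + cfStar α (n - 1))

/-- `κ²ₙ(α) = (1 − α*ₙ)(αₙ₊₁ + 1)/(αₙ₊₁ + α*ₙ)`. -/
noncomputable def kappa2 (α : ℝ) (n : ℕ) : ℝ :=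
  (1 - cfStar α n) * (cfTail α (n + 1) + 1) / (cfTail α (n + 1) + cfStar α n)

/-- `κ⁴ₙ(α) = 4/(αₙ + α*ₙ₋₁)`. -/
noncomputable def kappa4 (α : ℝ) (n : ℕ) : ℝ :=
  4 / (cfTail α n + cfStar α (n - 1))

theorem cfTail_succ_shift (α : ℝ) (n : ℕ) :
    cfTail α (n + 1) = cfTail (Int.fract α)⁻¹ n := by
  induction n with
  | zero => rfl
  | succ n ih => rw [cfTail, ih, ← cfTail]

theorem cfDigit_succ_shift (α : ℝ) (n : ℕ) :
    cfDigit α (n + 1) = cfDigit (Int.fract α)⁻¹ n := by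
  rw [cfDigit, cfDigit, cfTail_succ_shift]

theorem irrational_cfTail {α : ℝ} (h : Irrational α) (n : ℕ) : Irrational (cfTail α n) := by
  induction n with
  | zero => exact h
  | succ n ih => exact (ih.sub_intCast _).inv

theorem fract_cfTail_pos {α : ℝ} (h : Irrational α) (n : ℕ) : 0 < Int.fract (cfTail α n) := by
  refine lt_of_le_of_ne (Int.fract_nonneg _) (Ne.symm ?_)
  exact ((irrational_cfTail h n).sub_intCast _).ne_zero

theorem one_lt_cfTail_succ {α : ℝ} (h : Irrational α) (n : ℕ) : 1 < cfTail α (n + 1) :=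
  (one_lt_inv₀ (fract_cfTail_pos h n)).2 (Int.fract_lt_one _)

theorem cfTail_mul_succ {α : ℝ} (h : Irrational α) (n : ℕ) :
    cfTail α n * cfTail α (n + 1) = cfDigit α n * cfTail α (n + 1) + 1 := by
  have h1 : Int.fract (cfTail α n) * cfTail α (n + 1) = 1 :=
    mul_inv_cancel₀ (fract_cfTail_pos h n).ne'
  have h2 : (cfDigit α n : ℝ) + Int.fract (cfTail α n) = cfTail α n := Int.floor_add_fract _
  linear_combination h1 - cfTail α (n + 1) * h2

theorem one_le_cfDigit_succ {α : ℝ} (h : Irrational α) (n : ℕ) : 1 ≤ cfDigit α (n + 1) := by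
  rw [cfDigit, Int.le_floor]
  exact_mod_cast (one_lt_cfTail_succ h n).le

theorem one_le_cfDen {α : ℝ} (h : Irrational α) (n : ℕ) :
    1 ≤ cfDen α n ∧ 1 ≤ cfDen α (n + 1) := by
  induction n with
  | zero => exact ⟨le_rfl, one_le_cfDigit_succ h 0⟩
  | succ n ih =>
    refine ⟨ih.2, ?_⟩
    rw [cfDen]
    nlinarith [one_le_cfDigit_succ h (n + 1), ih.1, ih.2]

theorem cfDen_le_succ {α : ℝ} (h : Irrational α) (n : ℕ) : cfDen α n ≤ cfDen α (n + 1) := by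
  cases n with
  | zero => exact one_le_cfDigit_succ h 0
  | succ n =>
    rw [cfDen]
    nlinarith [one_le_cfDigit_succ h (n + 1), (one_le_cfDen h n).1, (one_le_cfDen h n).2]

theorem cfDen_monotone {α : ℝ} (h : Irrational α) : Monotone (cfDen α) :=
  monotone_nat_of_le_succ (cfDen_le_succ h)

theorem le_cfDen_succ {α : ℝ} (h : Irrational α) (n : ℕ) : (n : ℤ) ≤ cfDen α (n + 1) := by
  induction n with
  | zero => exact_mod_cast zero_le_one.trans (one_le_cfDen h 0).2
  | succ n ih =>
    rw [cfDen]
    push_cast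
    nlinarith [one_le_cfDigit_succ h (n + 1), (one_le_cfDen h n).1, (one_le_cfDen h n).2]

theorem cfNum_cfDen_det (α : ℝ) (n : ℕ) :
    (cfNum α (n + 1) * cfDen α n - cfNum α n * cfDen α (n + 1)) ^ 2 = 1 := by
  induction n with
  | zero => simp only [cfNum, cfDen]; ring
  | succ n ih =>
    rw [← ih, cfNum, cfDen]
    ring

theorem isCoprime_cfNum_cfDen (α : ℝ) (n : ℕ) : IsCoprime (cfNum α n) (cfDen α n) := by
  set d := cfNum α (n + 1) * cfDen α n - cfNum α n * cfDen α (n + 1) with hd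
  refine ⟨-d * cfDen α (n + 1), d * cfNum α (n + 1), ?_⟩
  linear_combination cfNum_cfDen_det α n - d * hd

theorem mul_cfDen_tail {α : ℝ} (h : Irrational α) (n : ℕ) :
    α * (cfDen α (n + 1) * cfTail α (n + 2) + cfDen α n) =
      cfNum α (n + 1) * cfTail α (n + 2) + cfNum α n := by
  induction n with
  | zero =>
    have h0 : α * cfTail α 1 = cfDigit α 0 * cfTail α 1 + 1 := cfTail_mul_succ h 0
    have h1 : cfTail α 1 * cfTail α 2 = cfDigit α 1 * cfTail α 2 + 1 := cfTail_mul_succ h 1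
    simp only [cfNum, cfDen, zero_add]
    push_cast
    linear_combination cfTail α 2 * h0 - (α - cfDigit α 0) * h1
  | succ n ih =>
    have h1 := cfTail_mul_succ h (n + 2)
    rw [cfNum, cfDen]
    push_cast
    linear_combination cfTail α (n + 3) * ih - (α * cfDen α (n + 1) - cfNum α (n + 1)) * h1

theorem cfDen_tail_pos {α : ℝ} (h : Irrational α) (n : ℕ) :
    0 < cfDen α (n + 1) * cfTail α (n + 2) + cfDen α n := by
  have h1 : (1 : ℝ) ≤ cfDen α n := by exact_mod_cast (one_le_cfDen h n).1
  have h2 : (1 : ℝ) ≤ cfDen α (n + 1) := by exact_mod_cast (one_le_cfDen h n).2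
  have h3 := one_lt_cfTail_succ h (n + 1)
  positivity

/-- The approximation error of an integer combination of two consecutive convergents. -/
theorem abs_combination_mul {α : ℝ} (h : Irrational α) (n : ℕ) (u v : ℝ) :
    |(u * cfDen α (n + 1) + v * cfDen α n) * α - (u * cfNum α (n + 1) + v * cfNum α n)| *
      (cfDen α (n + 1) * cfTail α (n + 2) + cfDen α n) = |u - v * cfTail α (n + 2)| := by
  have hd : |(cfNum α (n + 1) * cfDen α n - cfNum α n * cfDen α (n + 1) : ℝ)| = 1 := by
    rw [← sq_eq_sq₀ (abs_nonneg _) zero_le_one, sq_abs, one_pow]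
    exact_mod_cast cfNum_cfDen_det α n
  conv_lhs => rw [← abs_of_pos (cfDen_tail_pos h n), ← abs_mul]
  rw [← one_mul |u - v * cfTail α (n + 2)|, ← hd, ← abs_mul, ← abs_neg]
  congr 1
  linear_combination -(u * cfDen α (n + 1) + v * cfDen α n) * mul_cfDen_tail h n

/-- The pair `(p, q)` is not a convergent of `α`. -/
def NonConvergent (α : ℝ) (p q : ℤ) : Prop := ∀ n : ℕ, (p, q) ≠ (cfNum α n, cfDen α n)

theorem nonConvergent_two_mul (α : ℝ) (p q : ℤ) : NonConvergent α (2 * p) (2 * q) := by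
  intro n hn
  rw [Prod.mk.injEq] at hn
  obtain ⟨a, b, hab⟩ := isCoprime_cfNum_cfDen α n
  rw [← hn.1, ← hn.2] at hab
  have : 2 * (a * p + b * q) = 1 := by linear_combination hab
  omega

theorem nonConvergent_add {α : ℝ} (h : Irrational α) {n : ℕ} (hn : 2 ≤ cfDigit α (n + 2)) :
    NonConvergent α (cfNum α (n + 1) + cfNum α n) (cfDen α (n + 1) + cfDen α n) := by
  intro m hm
  rw [Prod.mk.injEq] at hm
  have h1 := (one_le_cfDen h n).1
  have h2 := (one_le_cfDen h n).2
  rcases Nat.lt_or_ge (n + 1) m with hlt | hge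
  · have h3 := cfDen_monotone h (Nat.succ_le_of_lt hlt)
    rw [Nat.succ_eq_add_one, cfDen] at h3
    nlinarith [hm.2]
  · have h3 := cfDen_monotone h hge
    linarith [hm.2]

theorem psi2_nonneg (α t : ℝ) : 0 ≤ psi2 α t := by
  refine Real.sInf_nonneg ?_
  rintro x ⟨p, q, -, -, -, rfl⟩
  exact abs_nonneg _

theorem isBoundedUnder_mul_psi2 (α : ℝ) :
    IsBoundedUnder (· ≥ ·) atTop (fun t : ℝ => t * psi2 α t) := by
  refine isBoundedUnder_of_eventually_ge (a := 0) ?_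
  filter_upwards [eventually_ge_atTop 0] with t ht
  exact mul_nonneg ht (psi2_nonneg α t)

theorem frequently_mul_psi2_le {α c : ℝ} (H : ∀ T : ℕ, ∃ p q : ℤ, 1 ≤ q ∧ (T : ℤ) ≤ q ∧
    NonConvergent α p q ∧ q * |q * α - p| ≤ c) :
    ∃ᶠ t : ℝ in atTop, t * psi2 α t ≤ c := by
  rw [frequently_atTop]
  intro a
  obtain ⟨T, hT⟩ := exists_nat_ge a
  obtain ⟨p, q, hq, hTq, hpq, hc⟩ := H T
  have hq0 : (1 : ℝ) ≤ q := by exact_mod_cast hq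
  have hTq' : (T : ℝ) ≤ q := by exact_mod_cast hTq
  refine ⟨q, hT.trans hTq', le_trans ?_ hc⟩
  refine mul_le_mul_of_nonneg_left (csInf_le ⟨0, ?_⟩ ⟨p, q, hq, le_rfl, hpq, rfl⟩) (by linarith)
  rintro x ⟨p, q, -, -, -, rfl⟩
  exact abs_nonneg _

theorem kConst_le {α c : ℝ} (H : ∀ T : ℕ, ∃ p q : ℤ, 1 ≤ q ∧ (T : ℤ) ≤ q ∧
    NonConvergent α p q ∧ q * |q * α - p| ≤ c) : kConst α ≤ c :=
  liminf_le_of_frequently_le (frequently_mul_psi2_le H) (isBoundedUnder_mul_psi2 α)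

theorem two_mul_cfDen_mul_error {α : ℝ} (h : Irrational α) (n : ℕ) :
    ((2 * cfDen α (n + 1) : ℤ) : ℝ) *
        |((2 * cfDen α (n + 1) : ℤ) : ℝ) * α - ((2 * cfNum α (n + 1) : ℤ) : ℝ)| =
      4 * cfDen α (n + 1) / (cfDen α (n + 1) * cfTail α (n + 2) + cfDen α n) := by
  have h1 := abs_combination_mul h n 2 0
  have hD := cfDen_tail_pos h n
  rw [eq_div_iff hD.ne']
  simp only [zero_mul, add_zero, sub_zero] at h1
  rw [show |(2 : ℝ)| = 2 by norm_num] at h1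
  push_cast
  linear_combination 2 * cfDen α (n + 1) * h1

theorem add_cfDen_mul_error {α : ℝ} (h : Irrational α) (n : ℕ) :
    ((cfDen α (n + 1) + cfDen α n : ℤ) : ℝ) *
        |((cfDen α (n + 1) + cfDen α n : ℤ) : ℝ) * α - ((cfNum α (n + 1) + cfNum α n : ℤ) : ℝ)| =
      (cfDen α (n + 1) + cfDen α n) * (cfTail α (n + 2) - 1) /
        (cfDen α (n + 1) * cfTail α (n + 2) + cfDen α n) := by
  have h1 := abs_combination_mul h n 1 1
  have hD := cfDen_tail_pos h n
  rw [eq_div_iff hD.ne']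
  simp only [one_mul] at h1
  rw [abs_sub_comm 1, abs_of_pos (sub_pos.2 (one_lt_cfTail_succ h (n + 1)))] at h1
  push_cast
  linear_combination (cfDen α (n + 1) + cfDen α n) * h1

theorem exists_nonConvergent_of_two_le_cfDigit {α : ℝ} (h : Irrational α) {n : ℕ}
    (hn : 2 ≤ cfDigit α (n + 2)) : ∃ p q : ℤ, 1 ≤ q ∧ (n : ℤ) ≤ q ∧
      NonConvergent α p q ∧ q * |q * α - p| ≤ 100 / 56 := by
  have hx : 2 ≤ cfTail α (n + 2) := by
    have := Int.le_floor.1 hn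
    exact_mod_cast this
  have h1 := (one_le_cfDen h n).1
  have h2 := (one_le_cfDen h n).2
  have h3 := le_cfDen_succ h n
  have h1' : (1 : ℝ) ≤ cfDen α n := by exact_mod_cast h1
  have h2' : (1 : ℝ) ≤ cfDen α (n + 1) := by exact_mod_cast h2
  have hD := cfDen_tail_pos h n
  by_cases hc : 2.24 * (cfDen α (n + 1) : ℝ) ≤ cfDen α (n + 1) * cfTail α (n + 2) + cfDen α n
  · refine ⟨_, _, by omega, by omega,
      nonConvergent_two_mul α (cfNum α (n + 1)) (cfDen α (n + 1)), ?_⟩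
    rw [two_mul_cfDen_mul_error h, div_le_iff₀ hD]
    linarith
  · refine ⟨_, _, by omega, by omega, nonConvergent_add h hn, ?_⟩
    rw [add_cfDen_mul_error h, div_le_iff₀ hD]
    push Not at hc
    have hx2 : cfTail α (n + 2) ≤ 2.24 := by nlinarith
    nlinarith

theorem cfTail_golden (n : ℕ) : cfTail Real.goldenRatio n = Real.goldenRatio := by
  induction n with
  | zero => rfl
  | succ n ih =>
    have h1 : ⌊Real.goldenRatio⌋ = 1 := by
      rw [Int.floor_eq_iff]
      norm_num
      exact ⟨Real.one_lt_goldenRatio.le, Real.goldenRatio_lt_two⟩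
    rw [cfTail, ih, ← Int.self_sub_floor, h1]
    refine (eq_inv_of_mul_eq_one_left ?_).symm
    push_cast
    linear_combination Real.goldenRatio_sq

theorem cfDigit_golden (n : ℕ) : cfDigit Real.goldenRatio n = 1 := by
  rw [cfDigit, cfTail_golden, Int.floor_eq_iff]
  norm_num
  exact ⟨Real.one_lt_goldenRatio.le, Real.goldenRatio_lt_two⟩

theorem cfEquiv_golden_iff (α : ℝ) :
    CFEquiv α Real.goldenRatio ↔ ∃ N : ℕ, ∀ k : ℕ, N ≤ k → cfDigit α k = 1 := by
  constructor
  · rintro ⟨n, m, -, -, H⟩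
    refine ⟨n + 1, fun k hk => ?_⟩
    obtain ⟨j, rfl⟩ := Nat.exists_eq_add_of_le hk
    rw [add_assoc, H _ (by omega), cfDigit_golden]
  · rintro ⟨N, H⟩
    exact ⟨N + 1, 1, by omega, by omega, fun k _ => by rw [H _ (by omega), cfDigit_golden]⟩

theorem cfTail_eq_golden {α : ℝ} (h : Irrational α) {N : ℕ}
    (H : ∀ k : ℕ, N ≤ k → cfDigit α k = 1) {k : ℕ} (hk : N ≤ k) :
    cfTail α k = Real.goldenRatio := by
  have hφ := Real.one_lt_goldenRatio
  have hφ0 := Real.goldenRatio_pos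
  have key : ∀ j k : ℕ, N ≤ k →
      |cfTail α k - Real.goldenRatio| ≤ (Real.goldenRatio⁻¹) ^ j := by
    intro j
    induction j with
    | zero =>
      intro k hk
      have h1 := H k hk
      rw [cfDigit, Int.floor_eq_iff] at h1
      push_cast at h1
      rw [pow_zero, abs_le]
      constructor <;> linarith [Real.goldenRatio_lt_two]
    | succ j ih =>
      intro k hk
      have h1 := ih (k + 1) (by omega)
      have h2 := cfTail_mul_succ h k
      have h3 := one_lt_cfTail_succ h k
      rw [H k hk] at h2
      push_cast at h2
      have h4 : |cfTail α k - Real.goldenRatio| * (cfTail α (k + 1) * Real.goldenRatio) =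
          |cfTail α (k + 1) - Real.goldenRatio| := by
        conv_lhs => rw [← abs_of_pos (show 0 < cfTail α (k + 1) * Real.goldenRatio by positivity),
          ← abs_mul]
        rw [← abs_neg]
        congr 1
        linear_combination -Real.goldenRatio * h2 + cfTail α (k + 1) * Real.goldenRatio_sq
      rw [pow_succ, ← div_eq_mul_inv, le_div_iff₀ hφ0]
      refine le_trans ?_ h1
      rw [← h4]
      refine mul_le_mul_of_nonneg_left ?_ (abs_nonneg _)
      nlinarith
  have hlim := tendsto_pow_atTop_nhds_zero_of_lt_one (inv_nonneg.2 hφ0.le) (inv_lt_one_of_one_lt₀ hφ)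
  have h0 : |cfTail α k - Real.goldenRatio| ≤ 0 :=
    ge_of_tendsto' hlim fun j => key j k hk
  exact sub_eq_zero.1 (abs_nonpos_iff.1 h0)

theorem sqrt_five_eq : √5 = 2 * Real.goldenRatio - 1 := by
  rw [Real.goldenRatio]; ring

theorem exists_nonConvergent_of_digits_one {α : ℝ} (h : Irrational α) {N : ℕ}
    (H : ∀ k : ℕ, N ≤ k → cfDigit α k = 1) (T : ℕ) : ∃ p q : ℤ, 1 ≤ q ∧ (T : ℤ) ≤ q ∧
      NonConvergent α p q ∧ q * |q * α - p| ≤ 4 / √5 := by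
  have hφ := Real.one_lt_goldenRatio
  have hφ2 := Real.goldenRatio_sq
  have hs := sqrt_five_eq
  have hs0 : 0 < √5 := by positivity
  obtain ⟨n, hTn, hNn, hn⟩ : ∃ n, T ≤ n ∧ N ≤ n ∧
      (cfDen α (n + 1) : ℝ) * (Real.goldenRatio - 1) ≤ cfDen α n := by
    by_cases hc : (cfDen α (max T N + 1) : ℝ) * (Real.goldenRatio - 1) ≤ cfDen α (max T N)
    · exact ⟨max T N, le_max_left _ _, le_max_right _ _, hc⟩
    · refine ⟨max T N + 1, by omega, by omega, ?_⟩
      rw [cfDen, H _ (by omega)]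
      push Not at hc
      push_cast
      linear_combination (Real.goldenRatio - 1) * hc + cfDen α (max T N + 1) * hφ2
  have h2 := (one_le_cfDen h n).2
  have h3 := le_cfDen_succ h n
  refine ⟨_, _, by omega, by omega,
      nonConvergent_two_mul α (cfNum α (n + 1)) (cfDen α (n + 1)), ?_⟩
  rw [two_mul_cfDen_mul_error h, div_le_div_iff₀ (cfDen_tail_pos h n) hs0,
    cfTail_eq_golden h H (show N ≤ n + 2 by omega), hs]
  linarith

theorem cfNum_cfDen_succ_shift (α : ℝ) (n : ℕ) :
    (cfNum α (n + 1) = ⌊α⌋ * cfNum (Int.fract α)⁻¹ n + cfDen (Int.fract α)⁻¹ n ∧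
      cfDen α (n + 1) = cfNum (Int.fract α)⁻¹ n) ∧
    (cfNum α (n + 2) = ⌊α⌋ * cfNum (Int.fract α)⁻¹ (n + 1) + cfDen (Int.fract α)⁻¹ (n + 1) ∧
      cfDen α (n + 2) = cfNum (Int.fract α)⁻¹ (n + 1)) := by
  have h0 : cfDigit α 0 = ⌊α⌋ := rfl
  induction n with
  | zero =>
    simp only [cfNum, cfDen, zero_add, ← cfDigit_succ_shift, h0]
    refine ⟨⟨by ring, trivial⟩, by ring, trivial⟩
  | succ n ih =>
    refine ⟨ih.2, ?_, ?_⟩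
    · rw [cfNum, ih.1.1, ih.2.1, cfDigit_succ_shift, cfNum, cfDen]
      ring
    · rw [cfDen, ih.1.2, ih.2.2, cfDigit_succ_shift, cfNum]

theorem convergent_eq_cfNum_div_cfDen {α : ℝ} (h : Irrational α) (n : ℕ) :
    α.convergent n = (cfNum α n : ℚ) / cfDen α n := by
  induction n generalizing α with
  | zero => simp [cfNum, cfDen, cfDigit, cfTail]
  | succ n ih =>
    have h1 := (cfNum_cfDen_succ_shift α n).1
    have h2 := (one_le_cfDen h n).2
    have h' : Irrational (Int.fract α)⁻¹ := irrational_cfTail h 1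
    have h3 : (cfNum (Int.fract α)⁻¹ n : ℚ) ≠ 0 := by
      rw [← h1.2]
      exact_mod_cast (by omega : cfDen α (n + 1) ≠ 0)
    rw [Real.convergent_succ, ih h', h1.1, h1.2]
    push_cast
    rw [inv_div, add_div, mul_div_cancel_right₀ _ h3]

/-- Legendre's criterion, for coprime pairs. -/
theorem not_nonConvergent_of_mul_error_lt {α : ℝ} (h : Irrational α) {p q : ℤ} (hq : 1 ≤ q)
    (hpq : IsCoprime p q) (hlt : q * |q * α - p| < 1 / 2) : ¬ NonConvergent α p q := by
  intro hnc
  have hq0 : (0 : ℝ) < q := by exact_mod_cast (by omega : 0 < q)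
  have hden : (((p : ℚ) / q).den : ℤ) = q := Rat.den_div_eq_of_coprime (by omega)
    (Int.isCoprime_iff_gcd_eq_one.1 hpq)
  have hden' : (((p : ℚ) / q).den : ℝ) = q := by exact_mod_cast hden
  obtain ⟨n, hn⟩ := Real.exists_rat_eq_convergent (ξ := α) (q := (p : ℚ) / q) (by
    rw [hden', lt_div_iff₀ (by positivity)]
    push_cast
    have h1 : |α - p / q| * q = |q * α - p| := by
      conv_lhs => rw [← abs_of_pos hq0, ← abs_mul]
      congr 1
      rw [abs_of_pos hq0]
      field_simp
    nlinarith)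
  rw [convergent_eq_cfNum_div_cfDen h] at hn
  have h1 := (one_le_cfDen h n).1
  have := Rat.div_int_inj (by omega) (by omega) (Int.isCoprime_iff_gcd_eq_one.1 hpq)
    (Int.isCoprime_iff_gcd_eq_one.1 (isCoprime_cfNum_cfDen α n)) hn
  exact hnc n (Prod.ext this.1 this.2)

theorem norm_form_eq_one {u v : ℤ} (h0 : u ^ 2 - u * v - v ^ 2 ≠ 0)
    (h4 : |u ^ 2 - u * v - v ^ 2| < 4) : |u ^ 2 - u * v - v ^ 2| = 1 := by
  have h2 : ∀ a b : ZMod 4, a ^ 2 - a * b - b ^ 2 ≠ 2 := by decide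
  have h3 : ∀ a b : ZMod 9, a ^ 2 - a * b - b ^ 2 ≠ 3 ∧ a ^ 2 - a * b - b ^ 2 ≠ -3 := by decide
  have h2' := h2 u v
  have h3' := h3 u v
  norm_cast at h2' h3'
  rw [abs_lt] at h4
  generalize u ^ 2 - u * v - v ^ 2 = m at *
  obtain ⟨h5, h6⟩ := h4
  interval_cases m <;> first | rfl | (exfalso; revert h0 h2' h3'; decide)

theorem le_mul_psi2 {α c t : ℝ} (ht : 2 ≤ t)
    (H : ∀ p q : ℤ, 1 ≤ q → (q : ℝ) ≤ t → NonConvergent α p q → c ≤ t * |q * α - p|) :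
    c ≤ t * psi2 α t := by
  rw [← div_le_iff₀' (by linarith)]
  refine le_csInf ⟨_, 2 * 0, 2 * 1, by norm_num, by norm_num; exact ht,
    nonConvergent_two_mul α 0 1, rfl⟩ ?_
  rintro x ⟨p, q, hq, hqt, hpq, rfl⟩
  rw [div_le_iff₀' (by linarith)]
  exact H p q hq hqt hpq

/-- The norm form `u² - uv - v²` computes `√5 · q · |qα - p|` up to a quadratic error. -/
theorem abs_norm_form_sub_le {Q₀ Q₁ D e u v q : ℝ} (hQ₀ : 0 ≤ Q₀) (hQ₁ : 0 ≤ Q₁)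
    (hD : D = Q₁ * Real.goldenRatio + Q₀) (hD0 : 0 < D) (hq : q = u * Q₁ + v * Q₀) (hq0 : 0 ≤ q)
    (he : e * D = |u - v * Real.goldenRatio|) :
    |(|u ^ 2 - u * v - v ^ 2| - √5 * (q * e))| ≤ 2 * (e * D) ^ 2 := by
  have hφ := Real.one_lt_goldenRatio
  have hφ' := Real.goldenRatio_lt_two
  have hs := sqrt_five_eq
  set w := u - v * Real.goldenRatio with hw
  have hqD : q / D = v + w * (Q₁ / D) := by
    field_simp
    rw [hq, hD, hw]
    ring
  have hm : u ^ 2 - u * v - v ^ 2 = w * (w + √5 * v) := by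
    rw [hw, hs]
    linear_combination v ^ 2 * Real.goldenRatio_sq
  have hqe : √5 * (q * e) = |w * (√5 * (v + w * (Q₁ / D)))| := by
    rw [← hqD, abs_mul, ← he, abs_of_nonneg (by positivity : 0 ≤ √5 * (q / D))]
    field_simp
  have hθ0 : 0 ≤ Q₁ / D := by positivity
  have hθ1 : Q₁ / D ≤ 1 := by
    rw [div_le_one hD0, hD]
    nlinarith
  have h1 : |1 - √5 * (Q₁ / D)| ≤ 2 := by
    rw [abs_le, hs]
    constructor <;> nlinarith
  rw [hm, hqe, he, sq_abs]
  refine (abs_abs_sub_abs_le _ _).trans ?_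
  rw [show w * (w + √5 * v) - w * (√5 * (v + w * (Q₁ / D))) = w ^ 2 * (1 - √5 * (Q₁ / D)) by ring,
    abs_mul, abs_of_nonneg (sq_nonneg w), mul_comm]
  exact mul_le_mul_of_nonneg_right h1 (sq_nonneg w)

theorem norm_form_ne_zero {u v : ℤ} (huv : u ≠ 0 ∨ v ≠ 0) : u ^ 2 - u * v - v ^ 2 ≠ 0 := by
  intro h0
  have h1 : ((u : ℝ) - v * Real.goldenRatio) * (u - v * Real.goldenConj) = 0 := by
    have h2 : (u : ℝ) ^ 2 - u * v - v ^ 2 = 0 := by exact_mod_cast h0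
    linear_combination h2 - u * v * Real.goldenRatio_add_goldenConj +
      v ^ 2 * Real.goldenRatio_mul_goldenConj
  have hv : v = 0 := by
    by_contra hv
    rcases mul_eq_zero.1 h1 with h2 | h2
    · exact ((Real.goldenRatio_irrational.intCast_mul hv).intCast_sub u).ne_zero h2
    · exact ((Real.goldenConj_irrational.intCast_mul hv).intCast_sub u).ne_zero h2
  subst hv
  simp at h0 huv
  exact huv h0

theorem le_kConst_of_digits_one {α : ℝ} (h : Irrational α) {N : ℕ}
    (H : ∀ k : ℕ, N ≤ k → cfDigit α k = 1) : 4 / √5 ≤ kConst α := by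
  have hs0 : 0 < √5 := by positivity
  have hs2 : 2.2 < √5 := by rw [Real.lt_sqrt (by norm_num)]; norm_num
  refine le_of_forall_lt fun c' hc' => ?_
  obtain ⟨c, hc'c, hc⟩ := exists_between hc'
  refine hc'c.trans_le (le_liminf_of_le
    (.of_frequently_le (frequently_mul_psi2_le (exists_nonConvergent_of_digits_one h H))) ?_)
  have hD0 := cfDen_tail_pos h N
  have hx := cfTail_eq_golden h H (show N ≤ N + 2 by omega)
  have habs := abs_combination_mul h N
  rw [hx] at hD0 habs
  set D := cfDen α (N + 1) * Real.goldenRatio + cfDen α N with hD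
  have hη : 0 < min 0.1 (4 - √5 * c) := by
    rw [lt_div_iff₀ hs0] at hc
    exact lt_min (by norm_num) (by linarith)
  set η := min 0.1 (4 - √5 * c)
  have hη1 : η ≤ 0.1 := min_le_left _ _
  have hη2 : η ≤ 4 - √5 * c := min_le_right _ _
  filter_upwards [eventually_ge_atTop 2, eventually_ge_atTop (8 * D ^ 2 / η)] with t ht2 htη
  refine le_mul_psi2 ht2 fun p q hq hqt hpq => ?_
  by_contra! hlt
  set s := cfNum α (N + 1) * cfDen α N - cfNum α N * cfDen α (N + 1) with hs
  have hs1 : s ^ 2 = 1 := cfNum_cfDen_det α N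
  set u := s * (p * cfDen α N - q * cfNum α N) with hu
  set v := s * (cfNum α (N + 1) * q - cfDen α (N + 1) * p) with hv
  have hqu : q = u * cfDen α (N + 1) + v * cfDen α N := by
    rw [hu, hv]
    linear_combination -q * hs1 + s * q * hs
  have hpu : p = u * cfNum α (N + 1) + v * cfNum α N := by
    rw [hu, hv]
    linear_combination -p * hs1 + s * p * hs
  have hqu' : (q : ℝ) = u * cfDen α (N + 1) + v * cfDen α N := by exact_mod_cast hqu
  have hpu' : (p : ℝ) = u * cfNum α (N + 1) + v * cfNum α N := by exact_mod_cast hpu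
  have he := habs u v
  rw [← hqu', ← hpu'] at he
  set e := |(q : ℝ) * α - p|
  have he0 : 0 ≤ e := abs_nonneg _
  have hq0 : (1 : ℝ) ≤ q := by exact_mod_cast hq
  have hQ₀ : (1 : ℝ) ≤ cfDen α N := by exact_mod_cast (one_le_cfDen h N).1
  have hQ₁ : (1 : ℝ) ≤ cfDen α (N + 1) := by exact_mod_cast (one_le_cfDen h N).2
  have hform := abs_norm_form_sub_le (zero_le_one.trans hQ₀) (zero_le_one.trans hQ₁) hD hD0 hqu'
    (by linarith) he
  have hte : t * e < 2 := by
    refine hlt.trans (hc.trans ?_)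
    rw [div_lt_iff₀ hs0]
    linarith
  have hsmall : 2 * (e * D) ^ 2 < η := by
    rw [div_le_iff₀ hη] at htη
    have h1 : (t * e) ^ 2 < 4 := by nlinarith [mul_nonneg (by linarith : 0 ≤ t) he0]
    have h2 : 8 * D ^ 2 ≤ t ^ 2 * η := by nlinarith
    have h3 : (t * e) ^ 2 * D ^ 2 < 4 * D ^ 2 := mul_lt_mul_of_pos_right h1 (by positivity)
    have h4 : t ^ 2 * (2 * (e * D) ^ 2) < t ^ 2 * η := by linarith
    exact lt_of_mul_lt_mul_left h4 (by positivity)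
  rw [abs_le] at hform
  have hqe : q * e < c := (mul_le_mul_of_nonneg_right hqt he0).trans_lt hlt
  have hm4 : |u ^ 2 - u * v - v ^ 2| < 4 := by
    have : |(u : ℝ) ^ 2 - u * v - v ^ 2| < 4 := by
      linarith [hform.2, mul_lt_mul_of_pos_left hqe hs0]
    exact_mod_cast this
  have hm0 : u ^ 2 - u * v - v ^ 2 ≠ 0 := by
    refine norm_form_ne_zero ?_
    by_contra! huv
    rw [huv.1, huv.2] at hqu
    omega
  have hm1 := norm_form_eq_one hm0 hm4
  have hm1' : |(u : ℝ) ^ 2 - u * v - v ^ 2| = 1 := by exact_mod_cast hm1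
  rw [hm1'] at hform
  have hcop : IsCoprime p q := by
    have hsq : (u ^ 2 - u * v - v ^ 2) ^ 2 = 1 := by rw [← sq_abs, hm1, one_pow]
    refine ⟨(u ^ 2 - u * v - v ^ 2) * (s * cfDen α N * (u - v) + s * cfDen α (N + 1) * v),
      (u ^ 2 - u * v - v ^ 2) * (-s * cfNum α N * (u - v) - s * cfNum α (N + 1) * v), ?_⟩
    linear_combination hsq - (u ^ 2 - u * v - v ^ 2) * ((u - v) * hu - v * hv)
  refine not_nonConvergent_of_mul_error_lt h hq hcop ?_ hpq
  change q * e < 1 / 2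
  have h1 : 2.2 * (q * e) ≤ √5 * (q * e) := mul_le_mul_of_nonneg_right hs2.le (by positivity)
  linarith [hform.1]

theorem kConst_eq_of_digits_one {α : ℝ} (h : Irrational α) {N : ℕ}
    (H : ∀ k : ℕ, N ≤ k → cfDigit α k = 1) : kConst α = 4 / √5 :=
  (kConst_le (exists_nonConvergent_of_digits_one h H)).antisymm (le_kConst_of_digits_one h H)

theorem kConst_lt_of_not_digits_one {α : ℝ} (h : Irrational α)
    (H : ¬ ∃ N : ℕ, ∀ k : ℕ, N ≤ k → cfDigit α k = 1) : kConst α < 4 / √5 := by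
  have hc : (100 / 56 : ℝ) < 4 / √5 := by
    have h1 : √5 < 2.24 := by rw [Real.sqrt_lt' (by norm_num)]; norm_num
    rw [div_lt_div_iff₀ (by norm_num) (by positivity)]
    linarith
  refine (kConst_le fun T => ?_).trans_lt hc
  push Not at H
  obtain ⟨k, hk, hk1⟩ := H (T + 2)
  obtain ⟨n, rfl⟩ := Nat.exists_eq_add_of_le' (show 2 ≤ k by omega)
  have h1 := one_le_cfDigit_succ h (n + 1)
  obtain ⟨p, q, hq, hn, hpq⟩ :=
    exists_nonConvergent_of_two_le_cfDigit h (n := n) (lt_of_le_of_ne h1 (Ne.symm hk1))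
  exact ⟨p, q, hq, by omega, hpq⟩

/-- The largest element of `𝕃₂` is `4/√5`; moreover, for irrational `α`,
`𝔨(α) = 4/√5` iff `α` is equivalent to the golden ratio `(1+√5)/2`. -/
theorem stmt_0 :
    IsGreatest L2 (4 / Real.sqrt 5) ∧
    ∀ α : ℝ, Irrational α →
      (kConst α = 4 / Real.sqrt 5 ↔ CFEquiv α ((1 + Real.sqrt 5) / 2)) := by
  have hiff : ∀ α : ℝ, Irrational α →
      (kConst α = 4 / Real.sqrt 5 ↔ CFEquiv α ((1 + Real.sqrt 5) / 2)) := by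
    intro α h
    rw [← Real.goldenRatio, cfEquiv_golden_iff]
    constructor
    · intro hk
      by_contra hN
      exact (kConst_lt_of_not_digits_one h hN).ne hk
    · rintro ⟨N, hN⟩
      exact kConst_eq_of_digits_one h hN
  refine ⟨⟨⟨Real.goldenRatio, Real.goldenRatio_irrational, ?_⟩, ?_⟩, hiff⟩
  · exact (kConst_eq_of_digits_one Real.goldenRatio_irrational (N := 0)
      fun k _ => cfDigit_golden k).symm
  · rintro _ ⟨α, h, rfl⟩
    by_cases hN : ∃ N : ℕ, ∀ k : ℕ, N ≤ k → cfDigit α k = 1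
    · obtain ⟨N, hN⟩ := hN
      exact (kConst_eq_of_digits_one h hN).le
    · exact (kConst_lt_of_not_digits_one h hN).le
end

section
/- For an irrational number α not equivalent to the golden ratio (1+√5)/2, the equality 𝔨(α) = 4/√17 holds if and only if α is equivalent to (1+√17)/2 = [2; 1,1,3, 1,1,3, …] (period 1,1,3). -/
open Filter

namespace SecondBest

theorem irrational_cfTail {α : ℝ} (hα : Irrational α) (n : ℕ) : Irrational (cfTail α n) := by
  induction n with
  | zero => exact hα
  | succ n ih =>
    simp only [cfTail, Int.fract]
    exact (ih.sub_intCast _).inv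

theorem fract_cfTail_pos {α : ℝ} (hα : Irrational α) (n : ℕ) : 0 < Int.fract (cfTail α n) := by
  refine lt_of_le_of_ne (Int.fract_nonneg _) fun h => ?_
  have := (irrational_cfTail hα n).sub_intCast ⌊cfTail α n⌋
  exact this.ne_zero h.symm

theorem one_lt_cfTail_succ {α : ℝ} (hα : Irrational α) (n : ℕ) : 1 < cfTail α (n + 1) :=
  (one_lt_inv₀ (fract_cfTail_pos hα n)).2 (Int.fract_lt_one _)

theorem one_le_cfDigit_succ {α : ℝ} (hα : Irrational α) (n : ℕ) : 1 ≤ cfDigit α (n + 1) :=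
  Int.le_floor.2 (by exact_mod_cast (one_lt_cfTail_succ hα n).le)

theorem cfTail_eq (α : ℝ) (n : ℕ) :
    cfTail α n = cfDigit α n + (cfTail α (n + 1))⁻¹ := by
  simp [cfTail, cfDigit, Int.floor_add_fract]

theorem cfTail_add (α : ℝ) (n k : ℕ) : cfTail α (n + k) = cfTail (cfTail α n) k := by
  induction k with
  | zero => rfl
  | succ k ih => rw [← add_assoc, cfTail, cfTail, ih]

theorem cfDigit_add (α : ℝ) (n k : ℕ) : cfDigit α (n + k) = cfDigit (cfTail α n) k := by
  simp only [cfDigit, cfTail_add]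

theorem cfDigit_succ (α : ℝ) (k : ℕ) : cfDigit α (k + 1) = cfDigit (cfTail α 1) k := by
  rw [add_comm, cfDigit_add]

theorem cfDen_pos {α : ℝ} (hα : Irrational α) (n : ℕ) : 0 < cfDen α n := by
  induction n using Nat.twoStepInduction with
  | zero => simp [cfDen]
  | one => have := one_le_cfDigit_succ hα 0; simp only [cfDen]; simp at this; omega
  | more n h0 h1 =>
    have := one_le_cfDigit_succ hα (n + 1)
    simp only [cfDen]
    positivity

theorem cfDen_add_le {α : ℝ} (hα : Irrational α) (n : ℕ) :
    cfDen α (n + 1) + cfDen α n ≤ cfDen α (n + 2) := by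
  have := one_le_cfDigit_succ hα (n + 1)
  have := cfDen_pos hα (n + 1)
  simp only [cfDen]
  nlinarith

theorem cfDen_monotone {α : ℝ} (hα : Irrational α) : Monotone (cfDen α) := by
  refine monotone_nat_of_le_succ fun n => ?_
  cases n with
  | zero => exact cfDen_pos hα 1
  | succ n =>
    have := cfDen_add_le hα n
    have := cfDen_pos hα n
    show cfDen α (n + 1) ≤ cfDen α (n + 2)
    omega

theorem le_cfDen {α : ℝ} (hα : Irrational α) (n : ℕ) : (n : ℤ) ≤ cfDen α n := by
  induction n using Nat.twoStepInduction with
  | zero => simp [cfDen]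
  | one => exact_mod_cast cfDen_pos hα 1
  | more n h0 h1 =>
    have := cfDen_add_le hα n
    have := cfDen_pos hα n
    push_cast at *
    omega

theorem cfNum_mul_cfDen_sub (α : ℝ) (n : ℕ) :
    cfNum α (n + 1) * cfDen α n - cfNum α n * cfDen α (n + 1) = (-1) ^ n := by
  induction n with
  | zero => simp [cfNum, cfDen]; ring
  | succ n ih =>
    rw [pow_succ, ← ih]
    simp only [cfNum, cfDen]
    ring

theorem isCoprime_cfNum_cfDen (α : ℝ) (n : ℕ) : IsCoprime (cfNum α n) (cfDen α n) := by
  have h := cfNum_mul_cfDen_sub α n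
  have h2 : ((-1 : ℤ) ^ n) * (-1) ^ n = 1 := by rw [← mul_pow]; simp
  exact ⟨-(-1) ^ n * cfDen α (n + 1), (-1) ^ n * cfNum α (n + 1), by
    linear_combination (-1) ^ n * h + h2⟩

theorem cfNum_cfDen_succ (α : ℝ) (n : ℕ) :
    cfNum α (n + 1) = cfDigit α 0 * cfNum (cfTail α 1) n + cfDen (cfTail α 1) n ∧
      cfDen α (n + 1) = cfNum (cfTail α 1) n := by
  induction n using Nat.twoStepInduction with
  | zero => simp [cfNum, cfDen, cfDigit_succ]; ring
  | one => simp [cfNum, cfDen, cfDigit_succ α 0, cfDigit_succ α 1]; ring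
  | more n h0 h1 =>
    obtain ⟨h0, h0'⟩ := h0
    obtain ⟨h1, h1'⟩ := h1
    constructor
    · rw [show n + 2 + 1 = (n + 1) + 2 from rfl, cfNum, cfDigit_succ α (n + 2), h0, h1]
      simp only [cfNum, cfDen]
      ring
    · rw [show n + 2 + 1 = (n + 1) + 2 from rfl, cfDen, cfDigit_succ α (n + 2), h0', h1']
      simp only [cfNum]

theorem convergent_eq {α : ℝ} (hα : Irrational α) (n : ℕ) :
    α.convergent n = (cfNum α n : ℚ) / cfDen α n := by
  induction n generalizing α with
  | zero => simp [cfNum, cfDen, cfDigit, cfTail]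
  | succ n ih =>
    have h1 := irrational_cfTail hα 1
    have hp := cfDen_pos hα (n + 1)
    obtain ⟨hN, hD⟩ := cfNum_cfDen_succ α n
    rw [Real.convergent_succ, show (Int.fract α)⁻¹ = cfTail α 1 from rfl, ih h1, hN, hD]
    rw [hD] at hp
    have : (cfNum (cfTail α 1) n : ℚ) ≠ 0 := by exact_mod_cast hp.ne'
    rw [show cfDigit α 0 = ⌊α⌋ from rfl]
    push_cast
    field_simp

/-- Legendre's criterion in terms of `cfNum` and `cfDen`. -/
theorem exists_eq_cfNum_cfDen {α : ℝ} (hα : Irrational α) {p q : ℤ} (hq : 0 < q)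
    (hpq : IsCoprime p q) (h : (q : ℝ) * |q * α - p| < 1 / 2) :
    ∃ n, (p, q) = (cfNum α n, cfDen α n) := by
  have hq' : (0 : ℝ) < q := by exact_mod_cast hq
  have hden : (((p : ℚ) / q).den : ℤ) = q := Rat.den_div_eq_of_coprime hq
    (Int.isCoprime_iff_gcd_eq_one.1 hpq)
  have hdenR : (((p : ℚ) / q).den : ℝ) = q := by exact_mod_cast congrArg (Int.cast : ℤ → ℝ) hden
  have habs : |α - ((p : ℚ) / q : ℚ)| = |q * α - p| / q := by
    rw [← abs_of_pos hq', ← abs_div, abs_of_pos hq']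
    push_cast
    congr 1
    field_simp
  obtain ⟨n, hn⟩ := Real.exists_rat_eq_convergent (ξ := α) (q := (p : ℚ) / q) (by
    rw [habs, hdenR, div_lt_div_iff₀ hq' (by positivity)]
    nlinarith)
  refine ⟨n, ?_⟩
  rw [convergent_eq hα] at hn
  have hc := Int.isCoprime_iff_gcd_eq_one.1 (isCoprime_cfNum_cfDen α n)
  have e1 := Rat.den_div_eq_of_coprime (cfDen_pos hα n) hc
  have e2 := Rat.num_div_eq_of_coprime (cfDen_pos hα n) hc
  have e3 := Rat.num_div_eq_of_coprime hq (Int.isCoprime_iff_gcd_eq_one.1 hpq)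
  rw [← hn] at e1 e2
  rw [← e1, ← e2, e3, hden]

theorem eq_of_cfDigit_eq {α β : ℝ} (h : ∀ k, cfDigit α k = cfDigit β k) : α = β := by
  have key : ∀ n, ∀ α β : ℝ, (∀ k, cfDigit α k = cfDigit β k) →
      α.convergent n = β.convergent n := by
    intro n
    induction n with
    | zero => intro α β h; simpa [cfDigit, cfTail] using h 0
    | succ n ih =>
      intro α β h
      have h0 : ⌊α⌋ = ⌊β⌋ := h 0
      rw [Real.convergent_succ, Real.convergent_succ, h0,
        ih (Int.fract α)⁻¹ (Int.fract β)⁻¹ fun k => ?_]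
      have := h (k + 1)
      rwa [cfDigit_succ, cfDigit_succ] at this
  have hA := GenContFract.of_convergence α
  have hB := GenContFract.of_convergence β
  refine tendsto_nhds_unique hA (hB.congr fun n => ?_)
  rw [Real.convs_eq_convergent, Real.convs_eq_convergent, key n α β h]

theorem cfDen_mul_sub {α : ℝ} (hα : Irrational α) (n : ℕ) :
    cfDen α n * α - cfNum α n = -(cfTail α (n + 2) * (cfDen α (n + 1) * α - cfNum α (n + 1))) := by
  have hT : ∀ n, cfTail α (n + 1) * (cfTail α n - cfDigit α n) = 1 := fun n => by
    have := one_lt_cfTail_succ hα n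
    rw [cfTail_eq α n]
    field_simp
    ring
  induction n with
  | zero =>
    have h0 := hT 0
    have h1 := hT 1
    simp only [cfNum, cfDen, zero_add]
    rw [show cfTail α 0 = α from rfl] at h0
    push_cast
    linear_combination (-(α - cfDigit α 0)) * h1 + cfTail α 2 * h0
  | succ n ih =>
    have := hT (n + 2)
    rw [show n + 1 + 1 = n + 2 from rfl, show n + 1 + 2 = n + 3 from rfl]
    rw [cfNum, cfDen]
    push_cast
    linear_combination (-(cfDen α (n + 1) * α - cfNum α (n + 1))) * this + cfTail α (n + 3) * ih

theorem abs_mul_cfDen_mul_cfTail_add {α : ℝ} (hα : Irrational α) (n : ℕ) :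
    |cfDen α (n + 1) * α - cfNum α (n + 1)| *
      (cfTail α (n + 2) * cfDen α (n + 1) + cfDen α n) = 1 := by
  have h1 := cfDen_mul_sub hα n
  have h2 : (cfNum α (n + 1) * cfDen α n - cfNum α n * cfDen α (n + 1) : ℝ) = (-1) ^ n := by
    exact_mod_cast cfNum_mul_cfDen_sub α n
  have hT := one_lt_cfTail_succ hα (n + 1)
  have hQ : (0 : ℝ) < cfDen α (n + 1) := by exact_mod_cast cfDen_pos hα _
  have hR : (0 : ℝ) < cfDen α n := by exact_mod_cast cfDen_pos hα _
  have hpos : 0 < cfTail α (n + 2) * cfDen α (n + 1) + cfDen α n := by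
    have : 0 < cfTail α (n + 2) := by linarith
    positivity
  rw [← abs_of_pos hpos, ← abs_mul]
  have : (cfDen α (n + 1) * α - cfNum α (n + 1)) *
      (cfTail α (n + 2) * cfDen α (n + 1) + cfDen α n) = -(-1) ^ n := by
    linear_combination (cfDen α (n + 1) : ℝ) * h1 - h2
  rw [this, abs_neg, abs_neg_one_pow]

theorem ne_convergent_of_between {α : ℝ} (hα : Irrational α) {p q : ℤ} {m : ℕ}
    (h1 : cfDen α m < q) (h2 : q < cfDen α (m + 1)) (n : ℕ) :
    (p, q) ≠ (cfNum α n, cfDen α n) := by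
  intro h
  obtain ⟨-, h⟩ := Prod.mk.inj h
  rcases le_or_gt n m with hn | hn
  · have := cfDen_monotone hα hn
    omega
  · have := cfDen_monotone hα (Nat.succ_le_of_lt hn)
    simp only [Nat.succ_eq_add_one] at this
    omega

theorem two_mul_ne_convergent (α : ℝ) (p q : ℤ) (n : ℕ) :
    (2 * p, 2 * q) ≠ (cfNum α n, cfDen α n) := by
  intro h
  obtain ⟨h1, h2⟩ := Prod.mk.inj h
  have := isCoprime_cfNum_cfDen α n
  rw [← h1, ← h2] at this
  have := this.isUnit_of_dvd' (dvd_mul_right 2 p) (dvd_mul_right 2 q)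
  simp [Int.isUnit_iff] at this

theorem psi2_nonneg (α t : ℝ) : 0 ≤ psi2 α t := by
  refine Real.sInf_nonneg ?_
  rintro x ⟨p, q, -, -, -, rfl⟩
  exact abs_nonneg _

theorem psi2_le {α : ℝ} {p q : ℤ} (hq : 1 ≤ q) (h : ∀ n, (p, q) ≠ (cfNum α n, cfDen α n)) :
    psi2 α q ≤ |q * α - p| := by
  refine csInf_le ⟨0, ?_⟩ ⟨p, q, hq, le_rfl, h, rfl⟩
  rintro x ⟨p, q, -, -, -, rfl⟩
  exact abs_nonneg _

theorem eventually_lt_of_lt_kConst {α c : ℝ} (h : c < kConst α) :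
    ∃ Q : ℝ, ∀ p q : ℤ, Q ≤ q → (∀ n, (p, q) ≠ (cfNum α n, cfDen α n)) →
      c < q * |q * α - p| := by
  have hb : IsBoundedUnder (· ≥ ·) atTop (fun t : ℝ => t * psi2 α t) :=
    ⟨0, eventually_map.2 <| (eventually_ge_atTop 0).mono fun t ht =>
      mul_nonneg ht (psi2_nonneg α t)⟩
  obtain ⟨Q, hQ⟩ := eventually_atTop.1 (eventually_lt_of_lt_liminf h hb)
  refine ⟨max Q 1, fun p q hq hpq => ?_⟩
  have hq1 : (1 : ℝ) ≤ q := (le_max_right _ _).trans hq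
  refine (hQ q ((le_max_left _ _).trans hq)).trans_le ?_
  gcongr
  exact psi2_le (by exact_mod_cast hq1) hpq

/-- Bounds on the continued fraction of `α` at the index `n` coming from twice the convergents and
from the first and last intermediate fractions. -/
theorem exists_forall_bounds {α c : ℝ} (hα : Irrational α) (h : c < kConst α) :
    ∃ N : ℕ, 0 < N ∧ ∀ n ≥ N, ∃ y : ℝ, 0 < y ∧ y ≤ 1 ∧ c * (cfTail α n + y) < 4 ∧
      (2 ≤ cfDigit α n → c * (cfTail α n + y) < (1 + y) * (cfTail α n - 1) ∧
        c * (cfTail α n + y) <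
          (cfDigit α n - 1 + y) * (cfTail α n - cfDigit α n + 1)) := by
  obtain ⟨Q₀, hQ₀⟩ := eventually_lt_of_lt_kConst h
  obtain ⟨M, hM⟩ := exists_nat_ge Q₀
  refine ⟨M + 2, by omega, fun n hn => ?_⟩
  obtain ⟨n, rfl⟩ : ∃ k, n = k + 2 := ⟨n - 2, by omega⟩
  have hQZ := cfDen_pos hα (n + 1)
  have hRZ := cfDen_pos hα n
  have hQ : (0 : ℝ) < cfDen α (n + 1) := by exact_mod_cast hQZ
  have hR : (0 : ℝ) < cfDen α n := by exact_mod_cast hRZ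
  have hRQ : (cfDen α n : ℝ) ≤ cfDen α (n + 1) := by
    exact_mod_cast cfDen_monotone hα (Nat.le_succ n)
  have hbig : Q₀ ≤ cfDen α (n + 1) := by
    have h1 : ((n + 1 : ℕ) : ℝ) ≤ cfDen α (n + 1) := by exact_mod_cast le_cfDen hα (n + 1)
    have h2 : (M : ℝ) ≤ (n + 1 : ℕ) := by exact_mod_cast (by omega)
    linarith
  have hE := abs_mul_cfDen_mul_cfTail_add hα n
  have hrec := cfDen_mul_sub hα n
  have hT := one_lt_cfTail_succ hα (n + 1)
  have hfl : (cfDigit α (n + 2) : ℝ) ≤ cfTail α (n + 2) := Int.floor_le _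
  have hnext : cfDen α (n + 2) = cfDigit α (n + 2) * cfDen α (n + 1) + cfDen α n := rfl
  have hbetween := fun (p q : ℤ) => ne_convergent_of_between hα (p := p) (q := q) (m := n + 1)
  rw [show n + 1 + 1 = n + 2 from rfl] at hT hbetween
  have h4 := hQ₀ (2 * cfNum α (n + 1)) (2 * cfDen α (n + 1)) (by push_cast; linarith)
    (two_mul_ne_convergent _ _ _)
  generalize cfTail α (n + 2) = T at *
  generalize cfDigit α (n + 2) = a at *
  have h1 := hQ₀ (cfNum α n + cfNum α (n + 1)) (cfDen α n + cfDen α (n + 1))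
    (by push_cast; linarith)
  have h2 := hQ₀ (cfNum α n + (a - 1) * cfNum α (n + 1)) (cfDen α n + (a - 1) * cfDen α (n + 1))
  set e := cfDen α (n + 1) * α - cfNum α (n + 1) with he
  have hden : 0 < T * cfDen α (n + 1) + cfDen α n := by
    have : 0 < T := by linarith
    positivity
  have habs : |e| = (T * cfDen α (n + 1) + cfDen α n)⁻¹ := eq_inv_of_mul_eq_one_left hE
  have hTy : T + cfDen α n / cfDen α (n + 1) =
      (T * cfDen α (n + 1) + cfDen α n) / cfDen α (n + 1) := by field_simp
  refine ⟨cfDen α n / cfDen α (n + 1), by positivity, (div_le_one hQ).2 hRQ, ?_, fun ha => ⟨?_, ?_⟩⟩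
  · rw [show ((2 * cfDen α (n + 1) : ℤ) : ℝ) * α - ((2 * cfNum α (n + 1) : ℤ) : ℝ) = 2 * e by
      rw [he]; push_cast; ring, abs_mul, abs_two, habs] at h4
    push_cast at h4
    rw [hTy, ← mul_div_assoc, div_lt_iff₀ hQ, ← lt_div_iff₀ hden]
    exact h4.trans_eq (by field_simp; ring)
  · have h1 := h1 (hbetween _ _ (by omega) (by rw [hnext]; nlinarith))
    rw [show ((cfDen α n + cfDen α (n + 1) : ℤ) : ℝ) * α
      - ((cfNum α n + cfNum α (n + 1) : ℤ) : ℝ) = -((T - 1) * e) by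
        push_cast; linear_combination hrec + he, abs_neg, abs_mul, habs,
        abs_of_pos (by linarith)] at h1
    push_cast at h1
    rw [hTy, ← mul_div_assoc, div_lt_iff₀ hQ, ← lt_div_iff₀ hden]
    exact h1.trans_eq (by field_simp; ring)
  · have h2 := h2 (by
      have : (1 : ℝ) ≤ (a - 1 : ℤ) := by exact_mod_cast (by omega)
      push_cast at this ⊢
      nlinarith) (fun k => by
        rcases ha.eq_or_lt with rfl | ha
        · exact hbetween _ _ (by omega) (by rw [hnext]; linarith) k
        · exact hbetween _ _ (by nlinarith) (by rw [hnext]; linarith) k)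
    rw [show ((cfDen α n + (a - 1) * cfDen α (n + 1) : ℤ) : ℝ) * α
      - ((cfNum α n + (a - 1) * cfNum α (n + 1) : ℤ) : ℝ) = -((T - a + 1) * e) by
        push_cast; linear_combination hrec + (a - 1) * he, abs_neg, abs_mul, habs,
        abs_of_pos (by linarith)] at h2
    push_cast at h2
    rw [hTy, ← mul_div_assoc, div_lt_iff₀ hQ, ← lt_div_iff₀ hden]
    exact h2.trans_eq (by field_simp; ring)

/-- If the partial quotient `3` occurs infinitely often, then `𝔨(α) ≤ 4 / √17`. -/
theorem kConst_le {α : ℝ} (hα : Irrational α) (h3 : ∀ N, ∃ n ≥ N, cfDigit α n = 3) :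
    kConst α ≤ 4 / Real.sqrt 17 := by
  by_contra! hlt
  obtain ⟨N, -, hN⟩ := exists_forall_bounds hα hlt
  obtain ⟨n, hn, ha⟩ := h3 N
  obtain ⟨y, hy0, hy1, h1, h2⟩ := hN n hn
  obtain ⟨h2, h3⟩ := h2 (by omega)
  have hfl : (cfDigit α n : ℝ) ≤ cfTail α n := Int.floor_le _
  rw [ha] at h3 hfl
  push_cast at h3 hfl
  generalize cfTail α n = T at *
  have hs : 0 < Real.sqrt 17 := by positivity
  have hss : Real.sqrt 17 ^ 2 = 17 := Real.sq_sqrt (by norm_num)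
  generalize Real.sqrt 17 = s at *
  rw [div_mul_eq_mul_div, div_lt_iff₀ hs] at h1 h2 h3
  have hs4 : 4 < s := by nlinarith
  obtain ⟨x, rfl⟩ : ∃ x, T = 3 + x := ⟨T - 3, by ring⟩
  have h5 : 3 + x + y < s := by linarith
  nlinarith [sq_nonneg (x - y), mul_pos hs (sub_pos.2 h5)]

/-- `α` is a root of an integral binary quadratic form of discriminant `17`. -/
def IsRootDisc17 (α : ℝ) : Prop :=
  ∃ A B C : ℤ, A * α ^ 2 + B * α + C = 0 ∧ B ^ 2 - 4 * A * C = 17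

theorem isRootDisc17_cfTail_succ_iff {α : ℝ} (hα : Irrational α) (n : ℕ) :
    IsRootDisc17 (cfTail α (n + 1)) ↔ IsRootDisc17 (cfTail α n) := by
  have hT := one_lt_cfTail_succ hα n
  rw [cfTail_eq α n]
  generalize cfTail α (n + 1) = T at *
  generalize cfDigit α n = a
  have hTT : T * T⁻¹ = 1 := mul_inv_cancel₀ (by linarith)
  constructor
  · rintro ⟨A, B, C, h, hd⟩
    refine ⟨C, B - 2 * a * C, A - a * B + a ^ 2 * C, ?_, by rw [← hd]; ring⟩
    push_cast
    linear_combination T⁻¹ ^ 2 * h - (A * (T * T⁻¹ + 1) + B * T⁻¹) * hTT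
  · rintro ⟨A, B, C, h, hd⟩
    refine ⟨A * a ^ 2 + B * a + C, 2 * A * a + B, A, ?_, by rw [← hd]; ring⟩
    push_cast
    linear_combination T ^ 2 * h - (A * (T * T⁻¹ + 1) + (2 * A * a + B) * T) * hTT

theorem isRootDisc17_cfTail_iff {α : ℝ} (hα : Irrational α) (n : ℕ) :
    IsRootDisc17 (cfTail α n) ↔ IsRootDisc17 α := by
  induction n with
  | zero => rfl
  | succ n ih => rw [isRootDisc17_cfTail_succ_iff hα, ih]

theorem irrational_sqrt_seventeen : Irrational (Real.sqrt 17) := by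
  exact_mod_cast Nat.Prime.irrational_sqrt (p := 17) (by norm_num)

theorem form_ne_zero {A B C p q : ℤ} (hd : B ^ 2 - 4 * A * C = 17) (hq : 0 < q) :
    A * p ^ 2 + B * p * q + C * q ^ 2 ≠ 0 := by
  intro h
  have h1 : (2 * A * p + B * q) ^ 2 = 17 * q ^ 2 := by
    linear_combination 4 * A * h + q ^ 2 * hd
  have hq' : (0 : ℝ) < q := by exact_mod_cast hq
  have h2 : Real.sqrt 17 = |((2 * A * p + B * q : ℤ) : ℝ) / q| := by
    rw [← Real.sqrt_sq_eq_abs, div_pow]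
    congr 1
    rw [eq_div_iff (by positivity)]
    exact_mod_cast h1.symm
  refine irrational_sqrt_seventeen ⟨|((2 * A * p + B * q : ℤ) : ℚ) / q|, ?_⟩
  rw [h2]
  push_cast
  rfl

theorem three_dvd_of_three_dvd_form {A B C p q : ℤ} (hd : B ^ 2 - 4 * A * C = 17)
    (h : 3 ∣ A * p ^ 2 + B * p * q + C * q ^ 2) : 3 ∣ p ∧ 3 ∣ q := by
  have key : ∀ A B C p q : ZMod 3, B ^ 2 - 4 * A * C = 17 →
      A * p ^ 2 + B * p * q + C * q ^ 2 = 0 → p = 0 ∧ q = 0 := by decide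
  have hd' := congrArg (Int.cast : ℤ → ZMod 3) hd
  have h' := (ZMod.intCast_zmod_eq_zero_iff_dvd _ 3).2 (by exact_mod_cast h)
  push_cast at hd' h'
  obtain ⟨h1, h2⟩ := key _ _ _ _ _ hd' h'
  exact ⟨by exact_mod_cast (ZMod.intCast_zmod_eq_zero_iff_dvd _ 3).1 h1,
    by exact_mod_cast (ZMod.intCast_zmod_eq_zero_iff_dvd _ 3).1 h2⟩

/-- A small nonzero value of a form of discriminant `17` is attained at coprime arguments and is
`±1` or `±2`. -/
theorem isCoprime_and_abs_form_le {A B C p q : ℤ} (hd : B ^ 2 - 4 * A * C = 17) (hq : 0 < q)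
    (h : |A * p ^ 2 + B * p * q + C * q ^ 2| < 4) :
    IsCoprime p q ∧ |A * p ^ 2 + B * p * q + C * q ^ 2| ≤ 2 := by
  have h0 := form_ne_zero (p := p) hd hq
  have hcop : IsCoprime p q := by
    rw [Int.isCoprime_iff_gcd_eq_one]
    obtain ⟨u, hu⟩ := Int.gcd_dvd_left p q
    obtain ⟨v, hv⟩ := Int.gcd_dvd_right p q
    have hg : 0 < Int.gcd p q := Int.gcd_pos_of_ne_zero_right _ hq.ne'
    generalize Int.gcd p q = g at *
    have hdvd : (g : ℤ) ^ 2 ∣ A * p ^ 2 + B * p * q + C * q ^ 2 :=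
      ⟨A * u ^ 2 + B * u * v + C * v ^ 2, by rw [hu, hv]; ring⟩
    have := Int.le_of_dvd (abs_pos.2 h0) ((dvd_abs _ _).2 hdvd)
    have : (g : ℤ) < 2 := by nlinarith
    omega
  refine ⟨hcop, ?_⟩
  by_contra! h2
  have h3 : 3 ∣ A * p ^ 2 + B * p * q + C * q ^ 2 := by
    rw [← dvd_abs]
    omega
  obtain ⟨h4, h5⟩ := three_dvd_of_three_dvd_form hd h3
  have := hcop.isUnit_of_dvd' h4 h5
  simp [Int.isUnit_iff] at this

theorem abs_abs_form_sub_le {α : ℝ} {A B C : ℤ} (h : A * α ^ 2 + B * α + C = 0)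
    (hd : B ^ 2 - 4 * A * C = 17) {p q : ℤ} (hq : 0 < q) :
    |((|A * p ^ 2 + B * p * q + C * q ^ 2| : ℤ) : ℝ) - Real.sqrt 17 * (q * |q * α - p|)| ≤
      |(A : ℝ)| * |q * α - p| ^ 2 := by
  have hq' : (0 : ℝ) < q := by exact_mod_cast hq
  have hd' : (B ^ 2 - 4 * A * C : ℝ) = 17 := by exact_mod_cast hd
  have hs : Real.sqrt 17 = |2 * A * α + B| := by
    rw [← Real.sqrt_sq_eq_abs]
    congr 1
    linear_combination -hd' - 4 * A * h
  have hF : (A * p ^ 2 + B * p * q + C * q ^ 2 : ℝ) =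
      -((2 * A * α + B) * (q * (q * α - p))) + A * (q * α - p) ^ 2 := by
    linear_combination q ^ 2 * h
  push_cast
  rw [hs, hF, ← abs_of_pos hq', ← abs_mul, abs_of_pos hq', ← abs_mul,
    ← abs_neg ((2 * A * α + B) * (q * (q * α - p))), ← abs_pow, ← abs_mul]
  refine (abs_abs_sub_abs_le _ _).trans_eq ?_
  congr 1
  ring

theorem exists_forall_le_mul_abs {α ε : ℝ} (hα : Irrational α) (hε : 0 < ε)
    (h : IsRootDisc17 α) :
    ∃ Q : ℝ, ∀ p q : ℤ, Q ≤ q → (∀ n, (p, q) ≠ (cfNum α n, cfDen α n)) →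
      4 / Real.sqrt 17 - ε ≤ q * |q * α - p| := by
  obtain ⟨A, B, C, h, hd⟩ := h
  have hs0 : 0 < Real.sqrt 17 := by positivity
  have hs : 4.1 < Real.sqrt 17 := by
    rw [Real.lt_sqrt (by norm_num)]; norm_num
  set δ := min ε 0.05 with hδ
  have hδ0 : 0 < δ := by positivity
  have hδ1 : δ ≤ ε := min_le_left _ _
  have hδ2 : δ ≤ 0.05 := min_le_right _ _
  refine ⟨max 1 (|(A : ℝ)| / δ), fun p q hq hpq => ?_⟩
  have hq1 : (1 : ℝ) ≤ q := (le_max_left _ _).trans hq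
  have hqA : |(A : ℝ)| ≤ q * δ := (div_le_iff₀ hδ0).1 ((le_max_right _ _).trans hq)
  have hqZ : 0 < q := by exact_mod_cast zero_lt_one.trans_le hq1
  have hF := abs_le.1 (abs_abs_form_sub_le h hd (p := p) hqZ)
  have hleg := exists_eq_cfNum_cfDen hα (p := p) hqZ
  have hsmall := isCoprime_and_abs_form_le (p := p) hd hqZ
  have hd0 := abs_nonneg (q * α - p)
  generalize |q * α - p| = d at *
  have hc : 4 / Real.sqrt 17 < 1 := by rw [div_lt_one hs0]; linarith
  rcases le_or_gt 1 (q * d) with h1 | h1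
  · linarith
  have hAd : |(A : ℝ)| * d ^ 2 ≤ δ := by
    calc |(A : ℝ)| * d ^ 2 ≤ (q * δ) * d ^ 2 := by gcongr
      _ = δ * ((q * d) * d) := by ring
      _ ≤ δ * (1 * 1) := by
        gcongr
        nlinarith
      _ = δ := by ring
  rcases lt_or_ge |A * p ^ 2 + B * p * q + C * q ^ 2| 4 with h4 | h4
  · obtain ⟨hcop, h2⟩ := hsmall h4
    have h2' : ((|A * p ^ 2 + B * p * q + C * q ^ 2| : ℤ) : ℝ) ≤ 2 := by exact_mod_cast h2
    obtain ⟨n, hn⟩ := hleg hcop (by nlinarith)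
    exact absurd hn (hpq n)
  · have h4' : (4 : ℝ) ≤ ((|A * p ^ 2 + B * p * q + C * q ^ 2| : ℤ) : ℝ) := by exact_mod_cast h4
    rw [sub_le_iff_le_add, div_le_iff₀ hs0]
    nlinarith

theorem exists_pos_forall_le_abs {α : ℝ} (hα : Irrational α) (Q : ℕ) :
    ∃ m > 0, ∀ p q : ℤ, 0 < q → q < Q → m ≤ |q * α - p| := by
  induction Q with
  | zero => exact ⟨1, one_pos, fun p q h1 h2 => by push_cast at h2; omega⟩
  | succ Q ih =>
    obtain ⟨m, hm, H⟩ := ih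
    rcases Nat.eq_zero_or_pos Q with rfl | hQ
    · exact ⟨1, one_pos, fun p q h1 h2 => by push_cast at h2; omega⟩
    have hirr : Irrational ((Q : ℝ) * α) := hα.natCast_mul hQ.ne'
    have hpos : 0 < |(Q : ℝ) * α - round ((Q : ℝ) * α)| :=
      abs_pos.2 (hirr.sub_intCast _).ne_zero
    refine ⟨min m _, lt_min hm hpos, fun p q h1 h2 => ?_⟩
    rcases (show q < Q ∨ q = Q by push_cast at h2; omega) with h | rfl
    · exact (min_le_left _ _).trans (H p q h1 h)
    · exact (min_le_right _ _).trans (by exact_mod_cast round_le ((Q : ℝ) * α) p)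

theorem isCoboundedUnder_mul_psi2 {α : ℝ} (hα : Irrational α) :
    IsCoboundedUnder (· ≥ ·) atTop (fun t : ℝ => t * psi2 α t) := by
  refine IsCoboundedUnder.of_frequently_le (a := 4) (frequently_atTop.2 fun t => ?_)
  obtain ⟨n, hn⟩ := exists_nat_ge t
  have hQZ := cfDen_pos hα (n + 1)
  have hQ : (0 : ℝ) < cfDen α (n + 1) := by exact_mod_cast hQZ
  have hR : (0 : ℝ) < cfDen α n := by exact_mod_cast cfDen_pos hα n
  have hE := abs_mul_cfDen_mul_cfTail_add hα n
  have hT := one_lt_cfTail_succ hα (n + 1)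
  rw [show n + 1 + 1 = n + 2 from rfl] at hT
  have hle : ((n + 1 : ℕ) : ℝ) ≤ cfDen α (n + 1) := by exact_mod_cast le_cfDen hα (n + 1)
  refine ⟨(2 * cfDen α (n + 1) : ℤ), by push_cast at *; linarith, ?_⟩
  have h := psi2_le (by omega) (two_mul_ne_convergent α (cfNum α (n + 1)) (cfDen α (n + 1)))
  refine (mul_le_mul_of_nonneg_left h (by positivity)).trans ?_
  rw [show ((2 * cfDen α (n + 1) : ℤ) : ℝ) * α - ((2 * cfNum α (n + 1) : ℤ) : ℝ) =
    2 * (cfDen α (n + 1) * α - cfNum α (n + 1)) by push_cast; ring, abs_mul, abs_two]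
  have he := abs_nonneg (cfDen α (n + 1) * α - cfNum α (n + 1))
  push_cast
  have : |cfDen α (n + 1) * α - cfNum α (n + 1)| * cfDen α (n + 1) ≤ 1 := by
    rw [← hE]
    gcongr
    nlinarith
  linarith

theorem le_kConst {α : ℝ} (hα : Irrational α) (h : IsRootDisc17 α) :
    4 / Real.sqrt 17 ≤ kConst α := by
  refine le_of_forall_pos_sub_le fun ε hε => ?_
  obtain ⟨Q, hQ⟩ := exists_forall_le_mul_abs hα hε h
  obtain ⟨M, hM⟩ := exists_nat_ge Q
  obtain ⟨m, hm, hmM⟩ := exists_pos_forall_le_abs hα M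
  refine le_liminf_of_le (isCoboundedUnder_mul_psi2 hα) ?_
  generalize 4 / Real.sqrt 17 - ε = c at *
  filter_upwards [eventually_ge_atTop (2 : ℝ), eventually_ge_atTop (c / m)] with t ht2 htm
  have ht : 0 < t := by linarith
  rw [← div_le_iff₀' ht]
  refine le_csInf ⟨_, 2 * cfNum α 0, 2 * cfDen α 0, by simp [cfDen], by simpa [cfDen] using ht2,
    two_mul_ne_convergent _ _ _, rfl⟩ ?_
  rintro x ⟨p, q, hq, hqt, hpq, rfl⟩
  rw [div_le_iff₀' ht]
  rcases lt_or_ge q M with hqM | hqM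
  · have := hmM p q (by omega) hqM
    rw [div_le_iff₀ hm] at htm
    exact htm.trans (by gcongr)
  · refine (hQ p q (hM.trans (by exact_mod_cast hqM)) hpq).trans ?_
    gcongr

theorem cfTail_succ_of_eq {α x y : ℝ} {n : ℕ} {a : ℤ} (hx : cfTail α n = x) (h1 : a ≤ x)
    (h2 : x < a + 1) (hy : (x - a) * y = 1) : cfDigit α n = a ∧ cfTail α (n + 1) = y := by
  have hfl : ⌊x⌋ = a := Int.floor_eq_iff.2 ⟨h1, h2⟩
  refine ⟨by rw [cfDigit, hx, hfl], ?_⟩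
  rw [cfTail, hx, Int.fract, hfl]
  exact inv_eq_of_mul_eq_one_right hy

theorem cfDigit_golden (n : ℕ) : cfDigit ((1 + Real.sqrt 5) / 2) n = 1 := by
  have hs : Real.sqrt 5 ^ 2 = 5 := Real.sq_sqrt (by norm_num)
  have hs0 : 0 ≤ Real.sqrt 5 := Real.sqrt_nonneg 5
  have key : ∀ n, cfTail ((1 + Real.sqrt 5) / 2) n = (1 + Real.sqrt 5) / 2 →
      cfDigit ((1 + Real.sqrt 5) / 2) n = 1 ∧
        cfTail ((1 + Real.sqrt 5) / 2) (n + 1) = (1 + Real.sqrt 5) / 2 := fun n hn =>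
    cfTail_succ_of_eq hn (by push_cast; nlinarith) (by push_cast; nlinarith)
      (by push_cast; linear_combination hs / 4)
  have htail : ∀ n, cfTail ((1 + Real.sqrt 5) / 2) n = (1 + Real.sqrt 5) / 2 := by
    intro n
    induction n with
    | zero => rfl
    | succ n ih => exact (key n ih).2
  exact (key n (htail n)).1

theorem cfDigit_sqrt_seventeen (k : ℕ) :
    cfDigit ((1 + Real.sqrt 17) / 2) (3 + 3 * k) = 3 ∧
      cfDigit ((1 + Real.sqrt 17) / 2) (3 + 3 * k + 1) = 1 ∧
      cfDigit ((1 + Real.sqrt 17) / 2) (3 + 3 * k + 2) = 1 := by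
  have hs : Real.sqrt 17 ^ 2 = 17 := Real.sq_sqrt (by norm_num)
  have hs0 : 4 < Real.sqrt 17 := by rw [Real.lt_sqrt (by norm_num)]; norm_num
  have hs1 : Real.sqrt 17 < 5 := by rw [Real.sqrt_lt' (by norm_num)]; norm_num
  have h0 : cfTail ((1 + Real.sqrt 17) / 2) 0 = (1 + Real.sqrt 17) / 2 := rfl
  generalize hβ : (1 + Real.sqrt 17) / 2 = β at h0 ⊢
  generalize Real.sqrt 17 = s at *
  have step2 : ∀ n, cfTail β n = (3 + s) / 4 →
      cfDigit β n = 1 ∧ cfTail β (n + 1) = (1 + s) / 4 := fun n hn =>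
    cfTail_succ_of_eq hn (by push_cast; linarith) (by push_cast; linarith)
      (by push_cast; linear_combination hs / 16)
  have step3 : ∀ n, cfTail β n = (1 + s) / 4 →
      cfDigit β n = 1 ∧ cfTail β (n + 1) = (3 + s) / 2 := fun n hn =>
    cfTail_succ_of_eq hn (by push_cast; linarith) (by push_cast; linarith)
      (by push_cast; linear_combination hs / 8)
  have step1 : ∀ n, cfTail β n = (3 + s) / 2 →
      cfDigit β n = 3 ∧ cfTail β (n + 1) = (3 + s) / 4 := fun n hn =>
    cfTail_succ_of_eq hn (by push_cast; linarith) (by push_cast; linarith)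
      (by push_cast; linear_combination hs / 8)
  have htail : cfTail β (3 + 3 * k) = (3 + s) / 2 := by
    induction k with
    | zero =>
      have h1 : cfTail β 1 = (3 + s) / 4 :=
        (cfTail_succ_of_eq (a := 2) (h0.trans hβ.symm) (by push_cast; linarith) (by push_cast; linarith)
          (by push_cast; linear_combination hs / 8)).2
      exact (step3 2 (step2 1 h1).2).2
    | succ k ih => exact (step3 _ (step2 _ (step1 _ ih).2).2).2
  exact ⟨(step1 _ htail).1, (step2 _ (step1 _ htail).2).1,
    (step3 _ (step2 _ (step1 _ htail).2).2).1⟩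

theorem exists_eq_one_or_three {α : ℝ} (hα : Irrational α) (h : 0.97 < kConst α) :
    ∃ N : ℕ, 0 < N ∧ ∀ n ≥ N, cfDigit α n = 1 ∨
      (cfDigit α n = 3 ∧ cfDigit α (n + 1) = 1 ∧ cfDigit α (n + 2) = 1 ∧
        cfDigit α (n + 3) = 3) := by
  obtain ⟨N, hN0, hN⟩ := exists_forall_bounds hα h
  have hT : ∀ n ≥ N, 1 < cfTail α n := fun n hn => by
    obtain ⟨k, rfl⟩ : ∃ k, n = k + 1 := ⟨n - 1, by omega⟩
    exact one_lt_cfTail_succ hα k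
  have hrec : ∀ n ≥ N, (cfTail α n - cfDigit α n) * cfTail α (n + 1) = 1 := fun n hn => by
    have := hT (n + 1) (by omega)
    rw [cfTail_eq α n]
    field_simp
    ring
  have hpos : ∀ n ≥ N, 1 ≤ cfDigit α n := fun n hn => by
    obtain ⟨k, rfl⟩ : ∃ k, n = k + 1 := ⟨n - 1, by omega⟩
    exact one_le_cfDigit_succ hα k
  have hup : ∀ n ≥ N, cfTail α n < 4.124 := fun n hn => by
    obtain ⟨y, hy0, hy1, h1, -⟩ := hN n hn
    norm_num at *
    linarith
  have hfrac : ∀ n ≥ N, 0.24 < cfTail α n - cfDigit α n := fun n hn => by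
    have h1 := hrec n hn
    have h2 := hup (n + 1) (by omega)
    have h3 := hT (n + 1) (by omega)
    norm_num at *
    nlinarith
  have hlt : ∀ n ≥ N, cfTail α n < cfDigit α n + 1 := fun n _ => Int.lt_floor_add_one _
  have h13 : ∀ n ≥ N, cfDigit α n = 1 ∨ cfDigit α n = 3 := fun n hn => by
    have h4 : cfDigit α n < 4 := by
      have h1 := hfrac n hn
      have h2 := hup n hn
      by_contra! h4
      have h4' : (4 : ℝ) ≤ cfDigit α n := by exact_mod_cast h4
      norm_num at *
      linarith
    have h2 : cfDigit α n ≠ 2 := fun h2 => by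
      obtain ⟨y, hy0, hy1, -, hb⟩ := hN n hn
      obtain ⟨hb, -⟩ := hb (by omega)
      have hr := hrec n hn
      have hr' := hrec (n + 1) (by omega)
      have hl := hlt n hn
      have hT1 := hT (n + 1) (by omega)
      have hu := hup (n + 2) (by omega)
      have hT2 := hT (n + 2) (by omega)
      rw [h2] at hr hl
      push_cast at hr hl
      have hx : 2.88 < cfTail α n := by norm_num at *; nlinarith
      have hp : (1 : ℝ) ≤ cfDigit α (n + 1) := by exact_mod_cast hpos (n + 1) (by omega)
      have h5 : cfTail α (n + 1) < 1.14 := by norm_num at *; nlinarith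
      rw [show n + 1 + 1 = n + 2 from rfl] at hr'
      norm_num at *
      nlinarith
    have := hpos n hn
    omega
  refine ⟨N, hN0, fun n hn => ?_⟩
  rcases h13 n hn with h1 | h3
  · exact Or.inl h1
  refine Or.inr ⟨h3, ?_⟩
  have hx : 1 / 3 < cfTail α n - 3 ∧ cfTail α n - 3 < 0.6 := by
    obtain ⟨y, hy0, hy1, hc, hb⟩ := hN n hn
    obtain ⟨hb1, hb2⟩ := hb (by omega)
    have hl := hlt n hn
    have hf := hfrac n hn
    rw [h3] at hb2 hl hf
    push_cast at hb2 hl hf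
    generalize cfTail α n = T at *
    obtain ⟨x, rfl⟩ : ∃ x, T = 3 + x := ⟨T - 3, by ring⟩
    constructor
    · by_contra! hcon
      norm_num at *
      nlinarith
    · by_contra! hcon
      norm_num at *
      nlinarith
  have hr0 := hrec n hn
  have hr1 := hrec (n + 1) (by omega)
  have hr2 := hrec (n + 2) (by omega)
  have hT1 := hT (n + 1) (by omega)
  have hT2 := hT (n + 2) (by omega)
  have hT3 := hT (n + 3) (by omega)
  have hf1 := Int.floor_le (cfTail α (n + 1))
  have hf2 := Int.floor_le (cfTail α (n + 2))
  rw [show n + 1 + 1 = n + 2 from rfl] at *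
  rw [show n + 2 + 1 = n + 3 from rfl] at *
  rw [h3] at hr0
  push_cast at hr0
  have h1 : cfDigit α (n + 1) = 1 := by
    refine (h13 (n + 1) (by omega)).resolve_right fun h => ?_
    have : (3 : ℝ) ≤ cfTail α (n + 1) := by rw [← cfDigit, h] at hf1; exact_mod_cast hf1
    nlinarith
  rw [h1] at hr1
  push_cast at hr1
  have h2 : cfDigit α (n + 2) = 1 := by
    refine (h13 (n + 2) (by omega)).resolve_right fun h => ?_
    have : (3 : ℝ) ≤ cfTail α (n + 2) := by rw [← cfDigit, h] at hf2; exact_mod_cast hf2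
    norm_num at *
    nlinarith
  rw [h2] at hr2
  push_cast at hr2
  refine ⟨h1, h2, (h13 (n + 3) (by omega)).resolve_left fun h => ?_⟩
  have h4 := hlt (n + 3) (by omega)
  rw [h] at h4
  push_cast at h4
  have h5 : 5 / 3 < cfTail α (n + 1) := by norm_num at *; nlinarith
  have h6 : cfTail α (n + 2) < 3 / 2 := by nlinarith
  nlinarith

theorem kConst_eq_of_cfEquiv {α : ℝ} (hα : Irrational α)
    (h : CFEquiv α ((1 + Real.sqrt 17) / 2)) : kConst α = 4 / Real.sqrt 17 := by
  obtain ⟨n, m, -, -, hnm⟩ := h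
  have hβ : Irrational ((1 + Real.sqrt 17) / 2) := by
    have := (irrational_sqrt_seventeen.intCast_add 1).div_natCast (m := 2) (by norm_num)
    exact_mod_cast this
  refine le_antisymm (kConst_le hα fun N => ?_) (le_kConst hα ?_)
  · have hk := hnm (3 + 3 * (N + m) - m) (by omega)
    refine ⟨n + (3 + 3 * (N + m) - m), by omega, ?_⟩
    rw [hk, show m + (3 + 3 * (N + m) - m) = 3 + 3 * (N + m) by omega]
    exact (cfDigit_sqrt_seventeen _).1
  · have heq : cfTail α (n + 1) = cfTail ((1 + Real.sqrt 17) / 2) (m + 1) :=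
      eq_of_cfDigit_eq fun k => by
        rw [← cfDigit_add, ← cfDigit_add, add_assoc, add_assoc]
        exact hnm (1 + k) (by omega)
    rw [← isRootDisc17_cfTail_iff hα (n + 1), heq, isRootDisc17_cfTail_iff hβ]
    refine ⟨1, -1, -4, ?_, by norm_num⟩
    have hs : Real.sqrt 17 ^ 2 = 17 := Real.sq_sqrt (by norm_num)
    push_cast
    linear_combination hs / 4

theorem cfEquiv_of_kConst_eq {α : ℝ} (hα : Irrational α)
    (h : ¬ CFEquiv α ((1 + Real.sqrt 5) / 2)) (hk : kConst α = 4 / Real.sqrt 17) :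
    CFEquiv α ((1 + Real.sqrt 17) / 2) := by
  obtain ⟨N, hN0, hN⟩ := exists_eq_one_or_three hα (by
    rw [hk, lt_div_iff₀ (by positivity), ← lt_div_iff₀' (by norm_num), Real.sqrt_lt' (by norm_num)]
    norm_num)
  obtain ⟨n, hn, hne⟩ : ∃ n ≥ N, cfDigit α n ≠ 1 := by
    by_contra! hcon
    exact h ⟨N, 1, hN0, one_pos, fun k _ => by rw [hcon _ (by omega), cfDigit_golden]⟩
  have hper : ∀ k, cfDigit α (n + 3 * k) = 3 ∧ cfDigit α (n + 3 * k + 1) = 1 ∧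
      cfDigit α (n + 3 * k + 2) = 1 := by
    intro k
    have key : cfDigit α (n + 3 * k) = 3 := by
      induction k with
      | zero => exact ((hN n hn).resolve_left hne).1
      | succ k ih =>
        exact ((hN (n + 3 * k) (by omega)).resolve_left (by omega)).2.2.2
    obtain ⟨-, h1, h2, -⟩ := (hN (n + 3 * k) (by omega)).resolve_left (by omega)
    exact ⟨key, h1, h2⟩
  refine ⟨n, 3, by omega, by omega, fun k _ => ?_⟩
  obtain ⟨a0, a1, a2⟩ := hper (k / 3)
  obtain ⟨b0, b1, b2⟩ := cfDigit_sqrt_seventeen (k / 3)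
  rcases (show k = 3 * (k / 3) ∨ k = 3 * (k / 3) + 1 ∨ k = 3 * (k / 3) + 2 by omega) with
    hk | hk | hk <;> rw [hk]
  · rw [a0, b0]
  · rw [← add_assoc, ← add_assoc, a1, b1]
  · rw [← add_assoc, ← add_assoc, a2, b2]

end SecondBest

/-- For irrational `α` not equivalent to the golden ratio, `𝔨(α) = 4/√17` iff
`α` is equivalent to `(1+√17)/2`. -/
theorem stmt_2 (α : ℝ) (hα : Irrational α)
    (h : ¬ CFEquiv α ((1 + Real.sqrt 5) / 2)) :
    kConst α = 4 / Real.sqrt 17 ↔ CFEquiv α ((1 + Real.sqrt 17) / 2) :=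
  ⟨SecondBest.cfEquiv_of_kConst_eq hα h, SecondBest.kConst_eq_of_cfEquiv hα⟩
end

section
/- The whole segment [0, 12/(21+√15)] is contained in the spectrum 𝕃₂, i.e., for every λ ∈ [0, 12/(21+√15)] there exists an irrational α with 𝔨(α) = λ. -/
open Filter

/-- `x n = [0; a n, a (n + 1), …]` for all `n`. -/
structure CFExpansion (a : ℕ → ℕ) (x : ℕ → ℝ) : Prop where
  one_le : ∀ n, 1 ≤ a n
  pos : ∀ n, 0 < x n
  lt_one : ∀ n, x n < 1
  mul_eq : ∀ n, x n * (a n + x (n + 1)) = 1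

/-- Every sequence of positive integers is the sequence of partial quotients of some number. -/
theorem exists_cfExpansion (a : ℕ → ℕ) (ha : ∀ n, 1 ≤ a n) : ∃ x, CFExpansion a x := by
  have ha' : ∀ n, (1 : ℝ) ≤ a n := fun n => by exact_mod_cast ha n
  let C : ℕ → Set (ℕ → ℝ) := fun n =>
    (Set.univ.pi fun _ => Set.Icc (0 : ℝ) 1) ∩ {x | ∀ i < n, x i * (a i + x (i + 1)) = 1}
  have hK : IsCompact (Set.univ.pi fun _ : ℕ => Set.Icc (0 : ℝ) 1) :=
    isCompact_univ_pi fun _ => isCompact_Icc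
  have hclosed : ∀ n, IsClosed {x : ℕ → ℝ | ∀ i < n, x i * (a i + x (i + 1)) = 1} := by
    intro n
    simp only [Set.ofPred_forall]
    exact isClosed_iInter fun i => isClosed_iInter fun _ =>
      isClosed_eq (by fun_prop) continuous_const
  have hne : ∀ n, (C n).Nonempty := by
    intro n
    have key : ∀ n : ℕ, ∀ b : ℕ → ℕ, (∀ i, (1 : ℝ) ≤ b i) → ∃ x : ℕ → ℝ,
        (∀ i, x i ∈ Set.Icc (0 : ℝ) 1) ∧ ∀ i < n, x i * (b i + x (i + 1)) = 1 := by
      intro n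
      induction n with
      | zero => exact fun b _ => ⟨fun _ => 0, by simp, by simp⟩
      | succ n ih =>
        intro b hb
        obtain ⟨x, hx, hx'⟩ := ih (fun i => b (i + 1)) fun i => hb _
        have h0 : 1 ≤ (b 0 : ℝ) + x 0 := by linarith [hb 0, (hx 0).1]
        refine ⟨fun i => Nat.casesOn i ((b 0 + x 0)⁻¹) x, ?_, ?_⟩
        · rintro (_ | i)
          · exact ⟨inv_nonneg.2 (by linarith), inv_le_one_of_one_le₀ h0⟩
          · exact hx i
        · rintro (_ | i) hi
          · exact inv_mul_cancel₀ (by linarith)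
          · exact hx' i (by omega)
    obtain ⟨x, hx, hx'⟩ := key n a ha'
    exact ⟨x, fun i _ => hx i, hx'⟩
  obtain ⟨x, hx⟩ := IsCompact.nonempty_iInter_of_sequence_nonempty_isCompact_isClosed C
    (fun n x hx => ⟨hx.1, fun i hi => hx.2 i (by omega)⟩) hne
    (hK.inter_right (hclosed 0)) fun n => hK.isClosed.inter (hclosed n)
  rw [Set.mem_iInter] at hx
  have hI : ∀ n, x n ∈ Set.Icc (0 : ℝ) 1 := fun n => (hx 0).1 n (Set.mem_univ n)
  have hmul : ∀ n, x n * (a n + x (n + 1)) = 1 := fun n => (hx (n + 1)).2 n (by omega)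
  have hpos : ∀ n, 0 < x n := fun n =>
    (hI n).1.lt_of_ne fun h => by have := hmul n; rw [← h] at this; simp at this
  refine ⟨x, ha, hpos, fun n => ?_, hmul⟩
  nlinarith [hmul n, hpos n, hpos (n + 1), ha' n, mul_pos (hpos n) (hpos (n + 1))]

namespace CFExpansion

variable {a : ℕ → ℕ} {x : ℕ → ℝ}

theorem one_le_cast (h : CFExpansion a x) (n : ℕ) : (1 : ℝ) ≤ a n := by exact_mod_cast h.one_le n

theorem inv_eq (h : CFExpansion a x) (n : ℕ) : (x n)⁻¹ = a n + x (n + 1) :=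
  (eq_inv_of_mul_eq_one_right (h.mul_eq n)).symm

theorem eq_inv (h : CFExpansion a x) (n : ℕ) : x n = (a n + x (n + 1) : ℝ)⁻¹ := by
  rw [← h.inv_eq, inv_inv]

theorem irrational (h : CFExpansion a x) : Irrational (x 0) := by
  have key : ∀ N : ℕ, ∀ n : ℕ, ∀ p q : ℤ, 0 < q → q < N → x n * q ≠ p := by
    intro N
    induction N with
    | zero => intro n p q h1 h2; push_cast at h2; omega
    | succ N ih =>
      intro n p q hq hN heq
      have hq' : (0 : ℝ) < q := by exact_mod_cast hq
      have hp : (0 : ℝ) < p := by rw [← heq]; exact mul_pos (h.pos n) hq'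
      have hpq : (p : ℝ) < q := by rw [← heq]; nlinarith [h.lt_one n]
      have hp' : 0 < p := by exact_mod_cast hp
      have hpq' : p < q := by exact_mod_cast hpq
      refine ih (n + 1) (q - a n * p) p hp' (by push_cast at hN; omega) ?_
      push_cast
      have := h.mul_eq n
      rw [← heq]
      linear_combination q * this
  rintro ⟨r, hr⟩
  refine key (r.den + 1) 0 r.num r.den (by exact_mod_cast r.pos) (by push_cast; omega) ?_
  rw [← hr]
  exact_mod_cast Rat.mul_den_eq_num r

theorem cfTail_succ (h : CFExpansion a x) (n : ℕ) : cfTail (x 0) (n + 1) = (x n)⁻¹ := by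
  induction n with
  | zero => rw [cfTail, cfTail, Int.fract_eq_self.2 ⟨(h.pos 0).le, h.lt_one 0⟩]
  | succ n ih =>
    rw [cfTail, ih, h.inv_eq, Int.fract_natCast_add,
      Int.fract_eq_self.2 ⟨(h.pos _).le, h.lt_one _⟩]

theorem cfDigit_zero (h : CFExpansion a x) : cfDigit (x 0) 0 = 0 :=
  Int.floor_eq_zero_iff.2 ⟨(h.pos 0).le, h.lt_one 0⟩

theorem cfDigit_succ (h : CFExpansion a x) (n : ℕ) : cfDigit (x 0) (n + 1) = a n := by
  rw [cfDigit, h.cfTail_succ, h.inv_eq, Int.floor_natCast_add,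
    Int.floor_eq_zero_iff.2 ⟨(h.pos _).le, h.lt_one _⟩, add_zero]

theorem cfDen_add_two (h : CFExpansion a x) (n : ℕ) :
    cfDen (x 0) (n + 2) = a (n + 1) * cfDen (x 0) (n + 1) + cfDen (x 0) n := by
  rw [cfDen, h.cfDigit_succ]

theorem cfNum_add_two (h : CFExpansion a x) (n : ℕ) :
    cfNum (x 0) (n + 2) = a (n + 1) * cfNum (x 0) (n + 1) + cfNum (x 0) n := by
  rw [cfNum, h.cfDigit_succ]

theorem det (h : CFExpansion a x) (n : ℕ) :
    cfNum (x 0) (n + 1) * cfDen (x 0) n - cfNum (x 0) n * cfDen (x 0) (n + 1) = (-1) ^ n := by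
  induction n with
  | zero => simp [cfNum, cfDen, h.cfDigit_zero]
  | succ n ih =>
    rw [h.cfDen_add_two, h.cfNum_add_two, pow_succ]
    linear_combination -ih

theorem cfDen_pos (h : CFExpansion a x) (n : ℕ) :
    0 < cfDen (x 0) n ∧ 0 < cfDen (x 0) (n + 1) := by
  induction n with
  | zero =>
    have := h.one_le 0
    simp only [cfDen, h.cfDigit_succ]
    omega
  | succ n ih =>
    have := h.one_le (n + 1)
    refine ⟨ih.2, ?_⟩
    rw [h.cfDen_add_two]
    have := ih.1
    have := ih.2
    positivity

theorem le_cfDen (h : CFExpansion a x) (n : ℕ) : (n : ℤ) ≤ cfDen (x 0) n := by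
  rcases n with _ | n
  · simp [cfDen]
  induction n with
  | zero => simpa using Int.add_one_le_iff.2 (h.cfDen_pos 0).2
  | succ n ih =>
    rw [h.cfDen_add_two]
    have h1 := h.one_le (n + 1)
    have h2 := (h.cfDen_pos n).1
    have h3 := (h.cfDen_pos n).2
    push_cast at ih ⊢
    have h1' : (1 : ℤ) ≤ a (n + 1) := by exact_mod_cast h1
    nlinarith

end CFExpansion

/-- `revTail a n = [0; a (n - 1), …, a 0]`. -/
noncomputable def revTail (a : ℕ → ℕ) : ℕ → ℝ
  | 0 => 0
  | n + 1 => (a n + revTail a n)⁻¹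

/-- The local quantity `[a n; a (n + 1), …] + [0; a (n - 1), …, a 0]`. -/
noncomputable def cfSum (a : ℕ → ℕ) (x : ℕ → ℝ) (n : ℕ) : ℝ := a n + x (n + 1) + revTail a n

theorem revTail_nonneg (a : ℕ → ℕ) (n : ℕ) : 0 ≤ revTail a n := by
  cases n with
  | zero => exact le_rfl
  | succ n => have := revTail_nonneg a n; rw [revTail]; positivity

namespace CFExpansion

variable {a : ℕ → ℕ} {x : ℕ → ℝ}

theorem revTail_le_one (h : CFExpansion a x) (n : ℕ) : revTail a n ≤ 1 := by
  cases n with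
  | zero => simp [revTail]
  | succ n =>
    rw [revTail]
    exact inv_le_one_of_one_le₀ (by linarith [h.one_le_cast n, revTail_nonneg a n])

theorem cfSum_pos (h : CFExpansion a x) (n : ℕ) : 0 < cfSum a x n := by
  have := h.one_le_cast n
  have := h.pos (n + 1)
  have := revTail_nonneg a n
  unfold cfSum
  positivity

theorem cfDen_succ (h : CFExpansion a x) (n : ℕ) :
    (cfDen (x 0) (n + 1) : ℝ) = cfDen (x 0) n * (a n + revTail a n) := by
  induction n with
  | zero => simp [cfDen, h.cfDigit_succ, revTail]
  | succ n ih =>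
    have h1 := h.one_le_cast n
    have h2 := revTail_nonneg a n
    have h3 : (a n + revTail a n : ℝ) ≠ 0 := by positivity
    rw [h.cfDen_add_two, revTail]
    push_cast
    rw [mul_add, ih]
    field_simp

theorem error_succ (h : CFExpansion a x) (n : ℕ) :
    cfDen (x 0) (n + 1) * x 0 - cfNum (x 0) (n + 1) =
      -(x (n + 1) * (cfDen (x 0) n * x 0 - cfNum (x 0) n)) := by
  induction n with
  | zero =>
    simp only [cfDen, cfNum, zero_add, h.cfDigit_zero, h.cfDigit_succ]
    push_cast
    linear_combination h.mul_eq 0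
  | succ n ih =>
    rw [h.cfDen_add_two, h.cfNum_add_two]
    push_cast
    have h1 := h.mul_eq (n + 1)
    linear_combination ((a (n + 1) : ℝ) + x (n + 1 + 1)) * ih -
      (cfDen (x 0) n * x 0 - cfNum (x 0) n) * h1

theorem error_mul (h : CFExpansion a x) (n : ℕ) :
    cfDen (x 0) n * |cfDen (x 0) n * x 0 - cfNum (x 0) n| * cfSum a x n = 1 := by
  have hd : ((cfNum (x 0) (n + 1) * cfDen (x 0) n - cfNum (x 0) n * cfDen (x 0) (n + 1) : ℤ) : ℝ)
      = ((-1) ^ n : ℤ) := by rw [h.det]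
  push_cast at hd
  have hq : (0 : ℝ) < cfDen (x 0) n := by exact_mod_cast (h.cfDen_pos n).1
  have e : (cfDen (x 0) n * (cfDen (x 0) n * x 0 - cfNum (x 0) n) * cfSum a x n : ℝ)
      = (-1) ^ n := by
    have e1 := h.error_succ n
    have e2 := h.cfDen_succ n
    rw [← hd, cfSum]
    linear_combination cfDen (x 0) n * e1 - (cfDen (x 0) n * x 0 - cfNum (x 0) n) * e2
  have := congrArg abs e
  rwa [abs_mul, abs_mul, abs_of_pos hq, abs_of_pos (h.cfSum_pos n), abs_pow, abs_neg, abs_one,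
    one_pow] at this

theorem isCoprime (h : CFExpansion a x) (n : ℕ) :
    IsCoprime (cfDen (x 0) n) (cfNum (x 0) n) := by
  refine ⟨(-1) ^ n * cfNum (x 0) (n + 1), -((-1) ^ n * cfDen (x 0) (n + 1)), ?_⟩
  have h1 := h.det n
  have h2 : ((-1 : ℤ) ^ n) * (-1) ^ n = 1 := by rw [← mul_pow]; simp
  linear_combination (-1) ^ n * h1 + h2

theorem exists_cfDen_le_lt (h : CFExpansion a x) {q : ℤ} (hq : 1 ≤ q) :
    ∃ n, cfDen (x 0) n ≤ q ∧ q < cfDen (x 0) (n + 1) := by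
  classical
  have hex : ∃ n, q < cfDen (x 0) n := ⟨q.toNat + 1, by
    have := h.le_cfDen (q.toNat + 1)
    push_cast at this
    omega⟩
  have hs := Nat.find_spec hex
  rcases hN : Nat.find hex with _ | n
  · rw [hN, cfDen] at hs
    omega
  · exact ⟨n, not_lt.1 (Nat.find_min hex (by omega)), hN ▸ hs⟩

/-- Legendre's criterion: an approximation with `q * |q * α - p| < 1 / 2` is proportional
to a convergent. -/
theorem mul_eq_mul_of_lt (h : CFExpansion a x) {p q : ℤ} {n : ℕ} (h1 : cfDen (x 0) n ≤ q)
    (h2 : q < cfDen (x 0) (n + 1)) (hlt : q * |q * x 0 - p| < 1 / 2) :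
    p * cfDen (x 0) n = q * cfNum (x 0) n := by
  have herr := h.error_succ n
  have hd := h.det n
  have hpos := (h.cfDen_pos n).1
  have hpos' := (h.cfDen_pos n).2
  have hx := h.pos (n + 1)
  generalize cfDen (x 0) n = Q at *
  generalize cfDen (x 0) (n + 1) = Q' at *
  generalize cfNum (x 0) n = P at *
  generalize cfNum (x 0) (n + 1) = P' at *
  generalize x (n + 1) = z at *
  generalize x 0 = α at *
  have hs : ((-1 : ℤ) ^ n) * (-1) ^ n = 1 := by rw [← mul_pow]; simp
  generalize (-1 : ℤ) ^ n = e at *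
  obtain ⟨u, v, hp, hq, hv⟩ : ∃ u v : ℤ, p = u * P + v * P' ∧ q = u * Q + v * Q' ∧
      v = e * (p * Q - q * P) :=
    ⟨-(e * (p * Q' - q * P')), e * (p * Q - q * P),
      by linear_combination (-p * e) * hd - p * hs,
      by linear_combination (-q * e) * hd - q * hs, rfl⟩
  by_contra hne
  have hv0 : v ≠ 0 := by
    rintro rfl
    apply hne
    linear_combination -e * hv - (p * Q - q * P) * hs
  have hv1 : (1 : ℝ) ≤ |(p * Q - q * P : ℝ)| := by
    have : (1 : ℤ) ≤ |p * Q - q * P| := Int.one_le_abs (sub_ne_zero.2 hne)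
    exact_mod_cast this
  have hQ : (0 : ℝ) < Q := by exact_mod_cast hpos
  have hQq : (Q : ℝ) ≤ q := by exact_mod_cast h1
  have hdec : (q * α - p : ℝ) = (u - v * z) * (Q * α - P) := by
    rw [hp, hq]
    push_cast
    linear_combination v * herr
  have hcoef : (1 : ℝ) ≤ |(u - v * z : ℝ)| := by
    rcases lt_or_gt_of_ne hv0 with hv' | hv'
    · have hu : 1 ≤ u := by
        by_contra hu
        nlinarith
      have hu' : (1 : ℝ) ≤ u := by exact_mod_cast hu
      have hv'' : (v : ℝ) < 0 := by exact_mod_cast hv'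
      exact le_trans (by nlinarith) (le_abs_self _)
    · have hu : u ≤ -1 := by
        by_contra hu
        nlinarith
      have hu' : (u : ℝ) ≤ -1 := by exact_mod_cast hu
      have hv'' : (0 : ℝ) < v := by exact_mod_cast hv'
      exact le_trans (by nlinarith) (neg_le_abs _)
  have hle : |(Q * α - P : ℝ)| ≤ |q * α - p| := by
    rw [hdec, abs_mul]
    exact le_mul_of_one_le_left (abs_nonneg _) hcoef
  have htri : |(p * Q - q * P : ℝ)| ≤ Q * |q * α - p| + q * |Q * α - P| := by
    have e : (p * Q - q * P : ℝ) = -(Q * (q * α - p)) + q * (Q * α - P) := by ring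
    rw [e]
    refine (abs_add_le _ _).trans (le_of_eq ?_)
    rw [abs_neg, abs_mul, abs_mul, abs_of_pos hQ, abs_of_pos (hQ.trans_le hQq)]
  nlinarith [abs_nonneg (q * α - p)]

theorem half_le_or_exists (h : CFExpansion a x) {p q : ℤ} (hq : 1 ≤ q)
    (hne : ∀ n : ℕ, (p, q) ≠ (cfNum (x 0) n, cfDen (x 0) n)) :
    1 / 2 ≤ q * |q * x 0 - p| ∨
      ∃ n, q < cfDen (x 0) (n + 1) ∧ 4 / cfSum a x n ≤ q * |q * x 0 - p| := by
  refine or_iff_not_imp_left.2 fun hlt => ?_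
  obtain ⟨n, h1, h2⟩ := h.exists_cfDen_le_lt hq
  refine ⟨n, h2, ?_⟩
  have hpq := h.mul_eq_mul_of_lt h1 h2 (not_le.1 hlt)
  have hpos := (h.cfDen_pos n).1
  obtain ⟨k, rfl⟩ : cfDen (x 0) n ∣ q :=
    (h.isCoprime n).dvd_of_dvd_mul_right ⟨p, by linear_combination -hpq⟩
  obtain rfl : p = k * cfNum (x 0) n := by
    apply mul_right_cancel₀ hpos.ne'
    rw [hpq]
    ring
  have hk0 : 0 < k := pos_of_mul_pos_right (by omega) hpos.le
  have hk1 : k ≠ 1 := by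
    rintro rfl
    exact hne n (by simp)
  have hk : (2 : ℝ) ≤ k := by exact_mod_cast (by omega : 2 ≤ k)
  rw [div_le_iff₀ (h.cfSum_pos n)]
  have e : ((cfDen (x 0) n * k : ℤ) * x 0 - (k * cfNum (x 0) n : ℤ) : ℝ) =
      k * (cfDen (x 0) n * x 0 - cfNum (x 0) n) := by push_cast; ring
  rw [e, abs_mul, abs_of_nonneg (by linarith)]
  push_cast
  have h1 := h.error_mul n
  calc (4 : ℝ) = 2 ^ 2 * (cfDen (x 0) n * |cfDen (x 0) n * x 0 - cfNum (x 0) n| * cfSum a x n) := by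
        rw [h1]; norm_num
    _ ≤ k ^ 2 * (cfDen (x 0) n * |cfDen (x 0) n * x 0 - cfNum (x 0) n| * cfSum a x n) := by
        rw [h1]; gcongr
    _ = _ := by ring

theorem kConst_eq (h : CFExpansion a x) {l : ℝ} (hl : l ≤ 1 / 2)
    (hlow : ∀ ε > 0, ∀ᶠ n in atTop, l - ε ≤ 4 / cfSum a x n)
    (hup : ∀ ε > 0, ∃ᶠ n in atTop, 4 / cfSum a x n ≤ l + ε) : kConst (x 0) = l := by
  have hbdd : ∀ t : ℝ, BddBelow { z : ℝ | ∃ p q : ℤ, 1 ≤ q ∧ (q : ℝ) ≤ t ∧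
      (∀ n : ℕ, (p, q) ≠ (cfNum (x 0) n, cfDen (x 0) n)) ∧ z = |(q : ℝ) * x 0 - (p : ℝ)| } :=
    fun t => ⟨0, by rintro _ ⟨p, q, -, -, -, rfl⟩; exact abs_nonneg _⟩
  have hodd : ∀ n m, (2 * cfNum (x 0) n, 2 * cfDen (x 0) n) ≠ (cfNum (x 0) m, cfDen (x 0) m) := by
    intro n m hnm
    simp only [Prod.mk.injEq] at hnm
    obtain ⟨u, v, huv⟩ := h.isCoprime m
    rw [← hnm.1, ← hnm.2] at huv
    have : (2 : ℤ) ∣ 1 := ⟨u * cfDen (x 0) n + v * cfNum (x 0) n, by rw [← huv]; ring⟩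
    omega
  have htend : Tendsto (fun n => (2 * cfDen (x 0) n : ℝ)) atTop atTop := by
    refine tendsto_atTop_mono (fun n => ?_) tendsto_natCast_atTop_atTop
    have h1 : ((n : ℤ) : ℝ) ≤ cfDen (x 0) n := by exact_mod_cast h.le_cfDen n
    have h2 : (0 : ℝ) < cfDen (x 0) n := by exact_mod_cast (h.cfDen_pos n).1
    push_cast at h1
    linarith
  have hfreq : ∀ ε > 0, ∃ᶠ t in atTop, t * psi2 (x 0) t ≤ l + ε := by
    intro ε hε
    refine htend.frequently ((hup ε hε).mono fun n hn => le_trans ?_ hn)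
    have hq : (0 : ℝ) < cfDen (x 0) n := by exact_mod_cast (h.cfDen_pos n).1
    have hle : psi2 (x 0) (2 * cfDen (x 0) n) ≤ 2 * |cfDen (x 0) n * x 0 - cfNum (x 0) n| := by
      refine csInf_le (hbdd _) ⟨2 * cfNum (x 0) n, 2 * cfDen (x 0) n, ?_, ?_, hodd n, ?_⟩
      · have := (h.cfDen_pos n).1
        omega
      · push_cast; exact le_rfl
      · push_cast
        rw [mul_assoc, ← mul_sub, abs_mul, abs_two]
    rw [le_div_iff₀ (h.cfSum_pos n)]
    have := h.error_mul n
    have hS := h.cfSum_pos n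
    calc _ ≤ 2 * cfDen (x 0) n * (2 * |cfDen (x 0) n * x 0 - cfNum (x 0) n|) * cfSum a x n := by
          gcongr
      _ = 4 := by linear_combination 4 * this
  have hev : ∀ ε > 0, ∀ᶠ t in atTop, l - ε ≤ t * psi2 (x 0) t := by
    intro ε hε
    obtain ⟨N, hN⟩ := eventually_atTop.1 (hlow ε hε)
    have hsmall : ∀ᶠ t : ℝ in atTop, ∀ q ∈ Finset.Icc 1 (cfDen (x 0) N),
        l ≤ t * |q * x 0 - round (q * x 0)| := by
      rw [Filter.eventually_all_finset]
      intro q hq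
      have hq1 : q ≠ 0 := by have := (Finset.mem_Icc.1 hq).1; omega
      have hpos : 0 < |q * x 0 - round (q * x 0)| :=
        abs_pos.2 (sub_ne_zero.2 ((h.irrational.intCast_mul hq1).ne_int _))
      filter_upwards [eventually_ge_atTop (l / |q * x 0 - round (q * x 0)|)] with t ht
      rwa [div_le_iff₀ hpos] at ht
    filter_upwards [hsmall, eventually_ge_atTop 2] with t ht ht2
    have ht0 : 0 < t := by linarith
    rw [← div_le_iff₀' ht0]
    refine le_csInf ?_ ?_
    · refine ⟨_, 2 * cfNum (x 0) 0, 2 * cfDen (x 0) 0, ?_, ?_, hodd 0, rfl⟩ <;> simp [cfDen, ht2]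
    rintro _ ⟨p, q, hq1, hqt, hne, rfl⟩
    rw [div_le_iff₀' ht0]
    have hqt' : (q : ℝ) * |q * x 0 - p| ≤ t * |q * x 0 - p| := by gcongr
    rcases h.half_le_or_exists hq1 hne with hh | ⟨n, hn, hh⟩
    · linarith
    · rcases le_or_gt q (cfDen (x 0) N) with hqN | hqN
      · have h1 := ht q (Finset.mem_Icc.2 ⟨hq1, hqN⟩)
        have h2 : t * |q * x 0 - round (q * x 0)| ≤ t * |q * x 0 - p| := by
          exact mul_le_mul_of_nonneg_left (round_le _ _) ht0.le
        linarith
      · have hmono : Monotone (cfDen (x 0)) := by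
          refine monotone_nat_of_le_succ fun n => ?_
          rcases n with _ | n
          · have := (h.cfDen_pos 0).2
            simp only [cfDen] at this ⊢
            omega
          · rw [h.cfDen_add_two]
            have h1 := (h.cfDen_pos n).1
            have h2 := (h.cfDen_pos n).2
            have h3 : (1 : ℤ) ≤ a (n + 1) := by exact_mod_cast h.one_le (n + 1)
            nlinarith
        have : N < n + 1 := hmono.reflect_lt (hqN.trans hn)
        linarith [hN n (by omega)]
  have hB : IsBoundedUnder (· ≥ ·) atTop fun t : ℝ => t * psi2 (x 0) t :=
    isBoundedUnder_of_eventually_ge (hev 1 one_pos)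
  have hC : IsCoboundedUnder (· ≥ ·) atTop fun t : ℝ => t * psi2 (x 0) t :=
    IsCoboundedUnder.of_frequently_le (hfreq 1 one_pos)
  refine le_antisymm (le_of_forall_pos_le_add fun ε hε => ?_)
    (le_of_forall_sub_le fun ε hε => ?_)
  · exact liminf_le_of_frequently_le (hfreq ε hε) hB
  · exact le_liminf_of_le hC (hev ε hε)

end CFExpansion


/-- `prepend [aₙ, …, a₁] z = [0; a₁, …, aₙ + z]`. -/
noncomputable def prepend : List ℕ → ℝ → ℝ
  | [], z => z
  | a :: u, z => prepend u (a + z)⁻¹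

theorem prepend_append (u v : List ℕ) (z : ℝ) : prepend (u ++ v) z = prepend v (prepend u z) := by
  induction u generalizing z with
  | nil => rfl
  | cons a u ih => exact ih _

theorem exists_prepend_inv_sub (u : List ℕ) (hu : ∀ a ∈ u, 1 ≤ a ∧ a ≤ 6) :
    ∃ q r e : ℝ, 1 ≤ q ∧ 0 ≤ r ∧ r ≤ q ∧ u.length + 1 ≤ q + r ∧ q ≤ 7 ^ u.length ∧
      (e = 1 ∨ e = -1) ∧ ∀ s t : ℝ, 0 < s → 0 < t →
        prepend u s⁻¹ - prepend u t⁻¹ = e * ((s - t) / ((q * s + r) * (q * t + r))) := by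
  induction u with
  | nil =>
    refine ⟨1, 0, -1, le_rfl, le_rfl, zero_le_one, by simp, by simp, Or.inr rfl, ?_⟩
    intro s t hs ht
    simp only [prepend]
    field_simp
    ring
  | cons a u ih =>
    obtain ⟨q, r, e, hq, hr, hrq, hlow, hup, he, hF⟩ := ih fun b hb => hu b (by simp [hb])
    have ha1 : (1 : ℝ) ≤ a := by exact_mod_cast (hu a (by simp)).1
    have ha6 : (a : ℝ) ≤ 6 := by exact_mod_cast (hu a (by simp)).2
    refine ⟨q * a + r, q, -e, by nlinarith, by linarith, by nlinarith, ?_, ?_, ?_, ?_⟩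
    · push_cast [List.length_cons]
      nlinarith
    · rw [List.length_cons, pow_succ]
      nlinarith
    · rcases he with rfl | rfl <;> simp
    · intro s t hs ht
      have h := hF (a + s⁻¹) (a + t⁻¹) (by positivity) (by positivity)
      rw [prepend, prepend, h]
      have h1 : q * (a + s⁻¹) + r ≠ 0 := by positivity
      have h2 : q * (a + t⁻¹) + r ≠ 0 := by positivity
      have h3 : (q * a + r) * s + q ≠ 0 := by positivity
      have h4 : (q * a + r) * t + q ≠ 0 := by positivity
      have e1 : q * (a + s⁻¹) + r = ((q * a + r) * s + q) / s := by field_simp; ring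
      have e2 : q * (a + t⁻¹) + r = ((q * a + r) * t + q) / t := by field_simp; ring
      rw [e1, e2]
      field_simp
      ring

/-- If a gap `(f₀, f₁)` of an interval is no longer than a second interval, removing it does
not change the sum of the two intervals. -/
theorem exists_add_eq_of_gap_le {e₀ f₀ f₁ e₁ a b x y : ℝ}
    (h : (e₀ ≤ f₀ ∧ f₀ ≤ f₁ ∧ f₁ ≤ e₁) ∨ (e₁ ≤ f₁ ∧ f₁ ≤ f₀ ∧ f₀ ≤ e₀))
    (hgap : |f₁ - f₀| ≤ |a - b|) (hx : x ∈ Set.uIcc e₀ e₁) (hy : y ∈ Set.uIcc a b) :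
    ∃ x' y', (x' ∈ Set.uIcc e₀ f₀ ∨ x' ∈ Set.uIcc f₁ e₁) ∧ y' ∈ Set.uIcc a b ∧
      x' + y' = x + y := by
  wlog hab : a ≤ b generalizing a b
  · rw [Set.uIcc_comm a b] at *
    rw [abs_sub_comm a b] at hgap
    exact this hgap hy (not_le.1 hab).le
  wlog hf : e₀ ≤ f₀ ∧ f₀ ≤ f₁ ∧ f₁ ≤ e₁ generalizing e₀ f₀ f₁ e₁
  · rw [Set.uIcc_comm] at hx
    rw [abs_sub_comm f₁] at hgap
    obtain ⟨x', y', h1, h2⟩ := this h.symm hx hgap (h.resolve_left hf)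
    rw [Set.uIcc_comm, Set.uIcc_comm f₀] at h1
    exact ⟨x', y', h1.symm, h2⟩
  obtain ⟨h1, h2, h3⟩ := hf
  rw [abs_of_nonneg (by linarith), abs_of_nonpos (by linarith)] at hgap
  rw [Set.uIcc_of_le (by linarith), Set.mem_Icc] at hx
  rw [Set.uIcc_of_le hab, Set.mem_Icc] at hy
  rw [Set.uIcc_of_le h1, Set.uIcc_of_le h3, Set.uIcc_of_le hab]
  simp only [Set.mem_Icc]
  rcases le_total x f₀ with hx0 | hx0
  · exact ⟨x, y, Or.inl ⟨hx.1, hx0⟩, hy, rfl⟩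
  rcases le_total f₁ x with hx1 | hx1
  · exact ⟨x, y, Or.inr ⟨hx1, hx.2⟩, hy, rfl⟩
  rcases le_total (y + (x - f₀)) b with hb | hb
  · exact ⟨f₀, y + (x - f₀), Or.inl ⟨h1, le_rfl⟩, ⟨by linarith, hb⟩, by ring⟩
  · exact ⟨f₁, y - (f₁ - x), Or.inr ⟨le_rfl, h3⟩, ⟨by linarith, by linarith⟩, by ring⟩

/-- The interval spanned by the numbers `[0; u.reverse, c, …]` with digits in `{1, …, 6}` and
`k ≤ c`, provided that `m = [0; 6, 1, 6, 1, …]`. -/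
def bridge (m : ℝ) (u : List ℕ) (k : ℕ) : Set ℝ :=
  Set.uIcc (prepend u (k + m)⁻¹) (prepend u (6 + 6 * m)⁻¹)

/-- The length of `bridge m u k`. -/
noncomputable def bridgeLength (m : ℝ) (u : List ℕ) (k : ℕ) : ℝ :=
  |prepend u (k + m)⁻¹ - prepend u (6 + 6 * m)⁻¹|

/-- The length of the gap in `bridge m u k` between the numbers with `c = k` and `c > k`. -/
noncomputable def bridgeGap (m : ℝ) (u : List ℕ) (k : ℕ) : ℝ :=
  |prepend u (k + 1 + m)⁻¹ - prepend u (k + 6 * m)⁻¹|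

section

variable {m : ℝ} {u : List ℕ} {k : ℕ}

theorem inv_six_add (hm' : 6 * m ^ 2 + 6 * m = 1) : (6 + 6 * m)⁻¹ = m :=
  inv_eq_of_mul_eq_one_left (by linear_combination hm')

theorem inv_one_add (hm' : 6 * m ^ 2 + 6 * m = 1) : (1 + m)⁻¹ = 6 * m :=
  inv_eq_of_mul_eq_one_left (by linear_combination hm')

theorem bridge_cons_one (hm' : 6 * m ^ 2 + 6 * m = 1) :
    bridge m (k :: u) 1 = Set.uIcc (prepend u (k + m)⁻¹) (prepend u (k + 6 * m)⁻¹) := by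
  rw [bridge, prepend, prepend, Nat.cast_one, inv_six_add hm', inv_one_add hm', Set.uIcc_comm]

theorem bridgeLength_cons_one (hm' : 6 * m ^ 2 + 6 * m = 1) :
    bridgeLength m (k :: u) 1 = |prepend u (k + 6 * m)⁻¹ - prepend u (k + m)⁻¹| := by
  rw [bridgeLength, prepend, prepend, Nat.cast_one, inv_six_add hm', inv_one_add hm']

theorem bridgeGap_cons_one_le (hm : 0 < m) (hm' : 6 * m ^ 2 + 6 * m = 1)
    (hu : ∀ a ∈ u, 1 ≤ a ∧ a ≤ 6) (hk : 1 ≤ k) {j : ℕ} (hj : k ≤ j) :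
    bridgeGap m (j :: u) 1 ≤ bridgeGap m u k := by
  obtain ⟨q, r, e, hq, hr, hrq, -, -, he, hF⟩ := exists_prepend_inv_sub u hu
  have he' : |e| = 1 := by rcases he with rfl | rfl <;> simp
  have hk' : (1 : ℝ) ≤ k := by exact_mod_cast hk
  have hj' : (k : ℝ) ≤ j := by exact_mod_cast hj
  have hm1 : m < 0.146 := by nlinarith
  have hj0 : (0 : ℝ) < j := by linarith
  rw [bridgeGap, bridgeGap, prepend, prepend, hF _ _ (by positivity) (by positivity),
    hF _ _ (by positivity) (by positivity), abs_mul, abs_mul, he', one_mul, one_mul, abs_div,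
    abs_div, Nat.cast_one]
  have e1 : (j + (1 + 1 + m)⁻¹ - (j + (1 + 6 * m)⁻¹) : ℝ)
      = -((1 - 5 * m) / ((2 + m) * (1 + 6 * m))) := by
    have : (1 + 1 + m) ≠ 0 := by positivity
    have : (2 + m) ≠ 0 := by positivity
    have : (1 + 6 * m) ≠ 0 := by positivity
    field_simp
    ring
  have e2 : (k + 1 + m - (k + 6 * m) : ℝ) = 1 - 5 * m := by ring
  rw [e1, e2, abs_neg, abs_of_pos (div_pos (by linarith) (by positivity)),
    abs_of_pos (by linarith : 0 < 1 - 5 * m), abs_of_pos (by positivity),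
    abs_of_pos (by positivity), div_div]
  have e3 : (2 + m) * (1 + 6 * m) * ((q * (j + (1 + 1 + m)⁻¹) + r) * (q * (j + (1 + 6 * m)⁻¹) + r))
      = (q * ((2 + m) * j + 1) + (2 + m) * r) * (q * ((1 + 6 * m) * j + 1) + (1 + 6 * m) * r) := by
    have : (1 + 1 + m) ≠ 0 := by positivity
    have : (2 + m) ≠ 0 := by positivity
    have : (1 + 6 * m) ≠ 0 := by positivity
    field_simp
    ring
  rw [e3]
  refine div_le_div_of_nonneg_left (by linarith) (by positivity) ?_
  have h1 : (k + 1 : ℝ) ≤ (2 + m) * j := by nlinarith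
  have h2 : (k : ℝ) ≤ (1 + 6 * m) * j := by nlinarith
  have h3 : r ≤ (2 + m) * r := by nlinarith
  have h4 : r ≤ (1 + 6 * m) * r := by nlinarith
  gcongr <;> linarith

theorem bridgeGap_succ_le (hm : 0 < m) (hm' : 6 * m ^ 2 + 6 * m = 1)
    (hu : ∀ a ∈ u, 1 ≤ a ∧ a ≤ 6) : bridgeGap m u (k + 1) ≤ bridgeGap m u k := by
  obtain ⟨q, r, e, hq, hr, hrq, -, -, he, hF⟩ := exists_prepend_inv_sub u hu
  have he' : |e| = 1 := by rcases he with rfl | rfl <;> simp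
  have hm1 : m < 0.146 := by nlinarith
  have e1 : (((k + 1 : ℕ) : ℝ) + 1 + m - ((k + 1 : ℕ) + 6 * m)) = 1 - 5 * m := by push_cast; ring
  have e2 : (k + 1 + m - (k + 6 * m) : ℝ) = 1 - 5 * m := by ring
  rw [bridgeGap, bridgeGap, hF _ _ (by positivity) (by positivity),
    hF _ _ (by positivity) (by positivity), abs_mul, abs_mul, he', one_mul, one_mul, abs_div,
    abs_div, e1, e2, abs_of_pos (by linarith : 0 < 1 - 5 * m), abs_of_pos (by positivity),
    abs_of_pos (by positivity)]
  refine div_le_div_of_nonneg_left (by linarith) (by positivity) ?_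
  push_cast
  gcongr <;> linarith

theorem bridgeGap_le_left (hm : 0 < m) (hm' : 6 * m ^ 2 + 6 * m = 1)
    (hu : ∀ a ∈ u, 1 ≤ a ∧ a ≤ 6) (hk : 1 ≤ k) :
    bridgeGap m u k ≤ |prepend u (k + 6 * m)⁻¹ - prepend u (k + m)⁻¹| := by
  obtain ⟨q, r, e, hq, hr, hrq, -, -, he, hF⟩ := exists_prepend_inv_sub u hu
  have he' : |e| = 1 := by rcases he with rfl | rfl <;> simp
  have hk' : (1 : ℝ) ≤ k := by exact_mod_cast hk
  have hm1 : m < 0.146 := by nlinarith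
  have hm2 : 0.145 < m := by nlinarith
  have e1 : (k + 6 * m - (k + m) : ℝ) = 5 * m := by ring
  have e2 : (k + 1 + m - (k + 6 * m) : ℝ) = 1 - 5 * m := by ring
  rw [bridgeGap, hF _ _ (by positivity) (by positivity),
    hF _ _ (by positivity) (by positivity), abs_mul, abs_mul, he', one_mul, one_mul, abs_div,
    abs_div, e1, e2, abs_of_pos (by linarith : 0 < 1 - 5 * m), abs_of_pos (by positivity),
    abs_of_pos (by positivity), abs_of_pos (by positivity)]
  refine div_le_div₀ (by positivity) (by linarith) (by positivity) ?_
  rw [mul_comm]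
  gcongr
  linarith

theorem bridgeGap_le_right (hm : 0 < m) (hm' : 6 * m ^ 2 + 6 * m = 1)
    (hu : ∀ a ∈ u, 1 ≤ a ∧ a ≤ 6) (hk : 1 ≤ k) (hk5 : k ≤ 5) :
    bridgeGap m u k ≤ |prepend u (k + 1 + m)⁻¹ - prepend u (6 + 6 * m)⁻¹| := by
  obtain ⟨q, r, e, hq, hr, hrq, -, -, he, hF⟩ := exists_prepend_inv_sub u hu
  have he' : |e| = 1 := by rcases he with rfl | rfl <;> simp
  have hk' : (1 : ℝ) ≤ k := by exact_mod_cast hk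
  have hk5' : (k : ℝ) ≤ 5 := by exact_mod_cast hk5
  have hm1 : m < 0.146 := by nlinarith
  have hm2 : 0.145 < m := by nlinarith
  have e1 : (k + 1 + m - (6 + 6 * m) : ℝ) = -(5 - k + 5 * m) := by ring
  have e2 : (k + 1 + m - (k + 6 * m) : ℝ) = 1 - 5 * m := by ring
  rw [bridgeGap, hF _ _ (by positivity) (by positivity),
    hF _ _ (by positivity) (by positivity), abs_mul, abs_mul, he', one_mul, one_mul, abs_div,
    abs_div, e1, e2, abs_neg, abs_of_pos (by linarith : 0 < 1 - 5 * m),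
    abs_of_pos (by linarith : 0 < 5 - (k : ℝ) + 5 * m), abs_of_pos (by positivity),
    abs_of_pos (by positivity), div_le_div_iff₀ (by positivity) (by positivity)]
  have key : (1 - 5 * m) * (q * (6 + 6 * m) + r) ≤ (5 - k + 5 * m) * (q * (k + 6 * m) + r) := by
    have h1 : (1 - 5 * m) * (6 + 6 * m) ≤ (5 - k + 5 * m) * (k + 6 * m) := by nlinarith
    have h2 : (1 - 5 * m) ≤ (5 - k + 5 * m) := by linarith
    nlinarith [mul_le_mul_of_nonneg_right h1 (by linarith : 0 ≤ q),
      mul_le_mul_of_nonneg_right h2 hr]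
  have hpos : 0 ≤ q * (k + 1 + m) + r := by positivity
  nlinarith [mul_le_mul_of_nonneg_right key hpos]

theorem bridgeGap_bounds (hm : 0 < m) (hm' : 6 * m ^ 2 + 6 * m = 1)
    (hu : ∀ a ∈ u, 1 ≤ a ∧ a ≤ 6) (hk : 1 ≤ k) (hk5 : k ≤ 5) :
    1 / (256 * 49 ^ u.length) ≤ bridgeGap m u k ∧ bridgeGap m u k ≤ 1 / (u.length + 1) := by
  obtain ⟨q, r, e, hq, hr, hrq, hlow, hup, he, hF⟩ := exists_prepend_inv_sub u hu
  have he' : |e| = 1 := by rcases he with rfl | rfl <;> simp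
  have hk' : (1 : ℝ) ≤ k := by exact_mod_cast hk
  have hk5' : (k : ℝ) ≤ 5 := by exact_mod_cast hk5
  have hm1 : m < 0.146 := by nlinarith
  have hm2 : 0.145 < m := by nlinarith
  have e2 : (k + 1 + m - (k + 6 * m) : ℝ) = 1 - 5 * m := by ring
  rw [bridgeGap, hF _ _ (by positivity) (by positivity), abs_mul, he', one_mul, abs_div, e2,
    abs_of_pos (by linarith : 0 < 1 - 5 * m), abs_of_pos (by positivity)]
  have hpow : (49 : ℝ) ^ u.length = 7 ^ u.length * 7 ^ u.length := by
    rw [← mul_pow]; norm_num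
  constructor
  · have h1 : q * (k + 1 + m) + r ≤ 8 * 7 ^ u.length := by nlinarith
    have h2 : q * (k + 6 * m) + r ≤ 8 * 7 ^ u.length := by nlinarith
    rw [div_le_div_iff₀ (by positivity) (by positivity), hpow]
    have h3 : (q * (k + 1 + m) + r) * (q * (k + 6 * m) + r)
        ≤ (8 * 7 ^ u.length) * (8 * 7 ^ u.length) := by gcongr
    have h4 : (0 : ℝ) ≤ 7 ^ u.length * 7 ^ u.length := by positivity
    nlinarith
  · refine div_le_div₀ zero_le_one (by linarith) (by positivity) ?_
    have h1 : (u.length : ℝ) + 1 ≤ q * (k + 1 + m) + r := by nlinarith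
    have h2 : 1 ≤ q * (k + 6 * m) + r := by nlinarith
    nlinarith

theorem prepend_inv_monotone_or (hu : ∀ a ∈ u, 1 ≤ a ∧ a ≤ 6) :
    (∀ s t : ℝ, 0 < s → s ≤ t → prepend u s⁻¹ ≤ prepend u t⁻¹) ∨
      ∀ s t : ℝ, 0 < s → s ≤ t → prepend u t⁻¹ ≤ prepend u s⁻¹ := by
  obtain ⟨q, r, e, hq, hr, -, -, -, he, hF⟩ := exists_prepend_inv_sub u hu
  have key : ∀ s t : ℝ, 0 < s → s ≤ t → 0 ≤ (t - s) / ((q * t + r) * (q * s + r)) := by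
    intro s t hs hst
    have ht : 0 < t := hs.trans_le hst
    exact div_nonneg (by linarith) (by positivity)
  rcases he with rfl | rfl
  · refine Or.inl fun s t hs hst => ?_
    have := hF t s (hs.trans_le hst) hs
    linarith [key s t hs hst]
  · refine Or.inr fun s t hs hst => ?_
    have := hF t s (hs.trans_le hst) hs
    linarith [key s t hs hst]

theorem exists_subbridge (hm : 0 < m) (hm' : 6 * m ^ 2 + 6 * m = 1)
    (hu : ∀ a ∈ u, 1 ≤ a ∧ a ≤ 6) (hk : 1 ≤ k) (hk5 : k ≤ 5) {x y a b : ℝ}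
    (hx : x ∈ bridge m u k) (hy : y ∈ Set.uIcc a b) (hgap : bridgeGap m u k ≤ |a - b|) :
    ∃ u' k' x' y', (∀ a ∈ u', 1 ≤ a ∧ a ≤ 6) ∧ 1 ≤ k' ∧ k' ≤ 5 ∧ x' ∈ bridge m u' k' ∧
      y' ∈ Set.uIcc a b ∧ x' + y' = x + y ∧ bridgeGap m u' k' ≤ bridgeGap m u k ∧
      bridgeGap m u k ≤ bridgeLength m u' k' ∧ u'.length ≤ u.length + 1 ∧
      5 * u.length + k + 1 ≤ 5 * u'.length + k' := by
  have hm1 : m < 0.146 := by nlinarith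
  have hk' : (1 : ℝ) ≤ k := by exact_mod_cast hk
  have hk5' : (k : ℝ) ≤ 5 := by exact_mod_cast hk5
  have hcons : ∀ j, 1 ≤ j → j ≤ 6 → ∀ a ∈ j :: u, 1 ≤ a ∧ a ≤ 6 := by
    intro j h1 h6 a ha
    rcases List.mem_cons.1 ha with rfl | ha
    exacts [⟨h1, h6⟩, hu a ha]
  obtain ⟨x', y', hx', hy', hxy⟩ := exists_add_eq_of_gap_le (e₀ := prepend u (k + m)⁻¹)
    (f₀ := prepend u (k + 6 * m)⁻¹) (f₁ := prepend u (k + 1 + m)⁻¹)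
    (e₁ := prepend u (6 + 6 * m)⁻¹) (by
      refine (prepend_inv_monotone_or hu).imp (fun h => ?_) fun h => ?_
      · exact ⟨h _ _ (by linarith) (by linarith), h _ _ (by linarith) (by linarith),
          h _ _ (by linarith) (by linarith)⟩
      · exact ⟨h _ _ (by linarith) (by linarith), h _ _ (by linarith) (by linarith),
          h _ _ (by linarith) (by linarith)⟩) hgap hx hy
  rcases hx' with hx' | hx'
  · refine ⟨k :: u, 1, x', y', hcons k hk (by omega), le_rfl, by norm_num, ?_, hy', hxy,
      bridgeGap_cons_one_le hm hm' hu hk le_rfl, ?_, by simp, by simp only [List.length_cons]; omega⟩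
    · rwa [bridge_cons_one hm']
    · rw [bridgeLength_cons_one hm']
      exact bridgeGap_le_left hm hm' hu hk
  rcases hk5.lt_or_eq with hlt | rfl
  · refine ⟨u, k + 1, x', y', hu, by omega, hlt, ?_, hy', hxy, bridgeGap_succ_le hm hm' hu, ?_,
      by omega, by omega⟩
    · rw [bridge]
      exact_mod_cast hx'
    · rw [bridgeLength]
      push_cast
      exact bridgeGap_le_right hm hm' hu hk hk5
  · have e : (((5 : ℕ) : ℝ) + 1 + m) = (6 : ℕ) + m := by push_cast; ring
    refine ⟨6 :: u, 1, x', y', hcons 6 (by norm_num) le_rfl, le_rfl, by norm_num, ?_, hy', hxy,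
      bridgeGap_cons_one_le hm hm' hu hk (by norm_num), ?_, by simp,
      by simp only [List.length_cons]; omega⟩
    · rw [bridge_cons_one hm', ← e]
      exact_mod_cast hx'
    · rw [bridgeLength_cons_one hm', ← e, abs_sub_comm]
      exact_mod_cast bridgeGap_le_right hm hm' hu hk hk5

end

/-- A pair of bridges whose sum contains `s`, where neither gap is longer than the other bridge. -/
structure BridgePair (m s : ℝ) (u v : List ℕ) (k l : ℕ) : Prop where
  left_mem : ∀ a ∈ u, 1 ≤ a ∧ a ≤ 6
  right_mem : ∀ a ∈ v, 1 ≤ a ∧ a ≤ 6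
  one_le_left : 1 ≤ k
  left_le : k ≤ 5
  one_le_right : 1 ≤ l
  right_le : l ≤ 5
  exists_add : ∃ x ∈ bridge m u k, ∃ y ∈ bridge m v l, x + y = s
  left_gap : bridgeGap m u k ≤ bridgeLength m v l
  right_gap : bridgeGap m v l ≤ bridgeLength m u k

namespace BridgePair

variable {m s : ℝ} {u v : List ℕ} {k l : ℕ}

theorem symm (h : BridgePair m s u v k l) : BridgePair m s v u l k where
  left_mem := h.right_mem
  right_mem := h.left_mem
  one_le_left := h.one_le_right
  left_le := h.right_le
  one_le_right := h.one_le_left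
  right_le := h.left_le
  exists_add := by
    obtain ⟨x, hx, y, hy, hxy⟩ := h.exists_add
    exact ⟨y, hy, x, hx, by rw [add_comm, hxy]⟩
  left_gap := h.right_gap
  right_gap := h.left_gap

theorem exists_split_left (hm : 0 < m) (hm' : 6 * m ^ 2 + 6 * m = 1)
    (h : BridgePair m s u v k l) (hgap : bridgeGap m v l ≤ bridgeGap m u k) :
    ∃ u' k', BridgePair m s u' v k' l ∧ u'.length ≤ u.length + 1 ∧
      5 * u.length + k + 1 ≤ 5 * u'.length + k' := by
  obtain ⟨x, hx, y, hy, hxy⟩ := h.exists_add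
  obtain ⟨u', k', x', y', h1, h2, h3, h4, h5, h6, h7, h8, h9, h10⟩ :=
    exists_subbridge hm hm' h.left_mem h.one_le_left h.left_le hx hy h.left_gap
  exact ⟨u', k', ⟨h1, h.right_mem, h2, h3, h.one_le_right, h.right_le,
    ⟨x', h4, y', h5, h6.trans hxy⟩, h7.trans h.left_gap, hgap.trans h8⟩, h9, h10⟩

theorem length_left_le (hm : 0 < m) (hm' : 6 * m ^ 2 + 6 * m = 1) {L : ℕ}
    (h : BridgePair m s u v k l) (hgap : bridgeGap m v l ≤ bridgeGap m u k)
    (hL : ¬ (L ≤ u.length ∧ L ≤ v.length)) : u.length ≤ 256 * 49 ^ L := by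
  rcases not_and_or.1 hL with hL | hL
  · have : L < 49 ^ L := Nat.lt_pow_self (by norm_num)
    omega
  · have h1 := (bridgeGap_bounds hm hm' h.right_mem h.one_le_right h.right_le).1
    have h2 := (bridgeGap_bounds hm hm' h.left_mem h.one_le_left h.left_le).2
    have h3 := (h1.trans hgap).trans h2
    rw [div_le_div_iff₀ (by positivity) (by positivity), one_mul, one_mul] at h3
    have h4 : (49 : ℝ) ^ v.length ≤ 49 ^ L :=
      pow_le_pow_right₀ (by norm_num) (by omega)
    have h5 : (u.length : ℝ) ≤ 256 * 49 ^ L := by linarith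
    exact_mod_cast h5

theorem exists_length_ge (hm : 0 < m) (hm' : 6 * m ^ 2 + 6 * m = 1)
    (h : BridgePair m s u v k l) (L : ℕ) :
    ∃ u' v' k' l', BridgePair m s u' v' k' l' ∧ L ≤ u'.length ∧ L ≤ v'.length := by
  by_contra! hcon
  have hcon' : ∀ u' v' k' l', BridgePair m s u' v' k' l' →
      ¬ (L ≤ u'.length ∧ L ≤ v'.length) := fun u' v' k' l' h' hL =>
    (hcon u' v' k' l' h' hL.1).not_ge hL.2
  set D := 256 * 49 ^ L + 1 + u.length + v.length with hD
  have key : ∀ n : ℕ, ∃ u' v' k' l', BridgePair m s u' v' k' l' ∧ u'.length ≤ D ∧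
      v'.length ≤ D ∧ n ≤ 5 * u'.length + k' + (5 * v'.length + l') := by
    intro n
    induction n with
    | zero => exact ⟨u, v, k, l, h, by omega, by omega, by omega⟩
    | succ n ih =>
      obtain ⟨u', v', k', l', h', hu', hv', hn⟩ := ih
      rcases le_total (bridgeGap m v' l') (bridgeGap m u' k') with hg | hg
      · obtain ⟨w, j, hw, hw1, hw2⟩ := h'.exists_split_left hm hm' hg
        have := h'.length_left_le hm hm' hg (hcon' _ _ _ _ h')
        exact ⟨w, v', j, l', hw, by omega, hv', by omega⟩
      · obtain ⟨w, j, hw, hw1, hw2⟩ := h'.symm.exists_split_left hm hm' hg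
        have := h'.symm.length_left_le hm hm' hg (hcon' _ _ _ _ h'.symm)
        exact ⟨u', w, k', j, hw.symm, hu', by omega, by omega⟩
  obtain ⟨u', v', k', l', h', hu', hv', hn⟩ := key (10 * D + 11)
  have := h'.left_le
  have := h'.right_le
  omega

end BridgePair

theorem abs_prepend_sub_le {u : List ℕ} (hu : ∀ a ∈ u, 1 ≤ a ∧ a ≤ 6) {z w : ℝ}
    (hz : z ∈ Set.Ioc (0 : ℝ) 1) (hw : w ∈ Set.Ioc (0 : ℝ) 1) :
    |prepend u z - prepend u w| ≤ 1 / (u.length + 1) := by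
  obtain ⟨q, r, e, hq, hr, -, hlow, -, he, hF⟩ := exists_prepend_inv_sub u hu
  have key : ∀ s t : ℝ, 1 ≤ s → 1 ≤ t →
      (s - t) / ((q * s + r) * (q * t + r)) ≤ 1 / (u.length + 1) := by
    intro s t hs ht
    rw [div_le_div_iff₀ (by positivity) (by positivity), one_mul]
    have h1 : s - t ≤ q * s + r := by nlinarith
    have h2 : (u.length : ℝ) + 1 ≤ q * t + r := by nlinarith
    exact mul_le_mul h1 h2 (by positivity) (by positivity)
  have hz1 : 1 ≤ z⁻¹ := (one_le_inv₀ hz.1).2 hz.2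
  have hw1 : 1 ≤ w⁻¹ := (one_le_inv₀ hw.1).2 hw.2
  have h := hF z⁻¹ w⁻¹ (by linarith) (by linarith)
  rw [inv_inv, inv_inv] at h
  have h1 := key _ _ hz1 hw1
  have h2 := key _ _ hw1 hz1
  rw [mul_comm, ← neg_sub z⁻¹, neg_div] at h2
  rw [h, abs_le]
  rcases he with rfl | rfl <;> constructor <;> linarith

theorem prepend_mem_Ioc {u : List ℕ} (hu : ∀ a ∈ u, 1 ≤ a ∧ a ≤ 6) {z : ℝ}
    (hz : z ∈ Set.Ioc (0 : ℝ) 1) : prepend u z ∈ Set.Ioc (0 : ℝ) 1 := by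
  induction u generalizing z with
  | nil => exact hz
  | cons a u ih =>
    have ha : (1 : ℝ) ≤ a := by exact_mod_cast (hu a (by simp)).1
    have := hz.1
    exact ih (fun b hb => hu b (by simp [hb])) ⟨by positivity, inv_le_one_of_one_le₀ (by linarith)⟩

theorem exists_digits_of_prepend (u : List ℕ) (hu : ∀ a ∈ u, 1 ≤ a ∧ a ≤ 6) :
    ∃ c : ℕ → ℕ, (∀ i, 1 ≤ c i ∧ c i ≤ 6) ∧ ∀ X : ℕ → ℝ,
      (∀ i < u.length, X i = (c i + X (i + 1) : ℝ)⁻¹) → X 0 = prepend u (X u.length) := by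
  induction u with
  | nil => exact ⟨fun _ => 1, by simp, fun X _ => rfl⟩
  | cons a u ih =>
    obtain ⟨c, hc, hX⟩ := ih fun b hb => hu b (by simp [hb])
    refine ⟨Function.update c u.length a, fun i => ?_, fun X h => ?_⟩
    · rcases eq_or_ne i u.length with rfl | hi
      · simpa using hu a (by simp)
      · simpa [hi] using hc i
    · rw [List.length_cons] at h
      have h1 := h u.length (by omega)
      rw [Function.update_self] at h1
      rw [hX X fun i hi => ?_, h1]
      · rfl
      · have := h i (by omega)
        rwa [Function.update_of_ne hi.ne] at this

theorem exists_word_of_mem_bridge {m : ℝ} (hm : 0 < m) {u : List ℕ}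
    (hu : ∀ a ∈ u, 1 ≤ a ∧ a ≤ 6) {k L : ℕ} (hk : 1 ≤ k) (hL : L ≤ u.length) {x : ℝ}
    (hx : x ∈ bridge m u k) :
    ∃ c : ℕ → ℕ, (∀ i, 1 ≤ c i ∧ c i ≤ 6) ∧ ∀ X : ℕ → ℝ,
      (∀ i < L, X i = (c i + X (i + 1) : ℝ)⁻¹) → X L ∈ Set.Ioc (0 : ℝ) 1 →
        |X 0 - x| ≤ 1 / (L + 1) := by
  have hk' : (1 : ℝ) ≤ k := by exact_mod_cast hk
  set u₀ := u.drop (u.length - L) with hu₀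
  have hlen : u₀.length = L := by rw [hu₀, List.length_drop]; omega
  have hmem : ∀ a ∈ u₀, 1 ≤ a ∧ a ≤ 6 := fun a ha => hu a (List.mem_of_mem_drop ha)
  have hsplit : ∀ z, prepend u z = prepend u₀ (prepend (u.take (u.length - L)) z) := fun z => by
    rw [← prepend_append, hu₀, List.take_append_drop]
  have htake : ∀ z ∈ Set.Ioc (0 : ℝ) 1, prepend (u.take (u.length - L)) z ∈ Set.Ioc (0 : ℝ) 1 :=
    fun z hz => prepend_mem_Ioc (fun a ha => hu a (List.mem_of_mem_take ha)) hz
  obtain ⟨c, hc, hX⟩ := exists_digits_of_prepend u₀ hmem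
  rw [hlen] at hX
  refine ⟨c, hc, fun X h hXL => ?_⟩
  rw [hX X h]
  have h1 := abs_prepend_sub_le hmem hXL (htake (k + m)⁻¹
    ⟨by positivity, inv_le_one_of_one_le₀ (by linarith)⟩)
  have h2 := abs_prepend_sub_le hmem hXL (htake (6 + 6 * m)⁻¹
    ⟨by positivity, inv_le_one_of_one_le₀ (by linarith)⟩)
  rw [← hsplit, hlen, abs_le] at h1 h2
  rw [abs_le]
  rcases Set.mem_uIcc.1 hx with hx | hx <;> constructor <;> linarith [hx.1, hx.2]

/-- Every number in `[1/2, 3/2]` is a sum of two continued fractions with digits at most `6`,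
in a finitary form. -/
theorem exists_digits_add {s : ℝ} (hs : s ∈ Set.Icc (1 / 2 : ℝ) (3 / 2)) (L : ℕ) :
    ∃ c d : ℕ → ℕ, (∀ i, 1 ≤ c i ∧ c i ≤ 6) ∧ (∀ i, 1 ≤ d i ∧ d i ≤ 6) ∧ ∀ X Y : ℕ → ℝ,
      (∀ i < L, X i = (c i + X (i + 1) : ℝ)⁻¹) → (∀ i < L, Y i = (d i + Y (i + 1) : ℝ)⁻¹) →
        X L ∈ Set.Ioc (0 : ℝ) 1 → Y L ∈ Set.Ioc (0 : ℝ) 1 →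
          |X 0 + Y 0 - s| ≤ 2 / (L + 1) := by
  obtain ⟨m, hm, hm'⟩ : ∃ m : ℝ, 0 < m ∧ 6 * m ^ 2 + 6 * m = 1 := by
    refine ⟨(√15 - 3) / 6, ?_, ?_⟩
    · have : 3 < √15 := Real.lt_sqrt_of_sq_lt (by norm_num)
      linarith
    · have : √15 ^ 2 = 15 := Real.sq_sqrt (by norm_num)
      linear_combination this / 6
  have hm1 : m < 0.146 := by nlinarith
  have hm2 : 0.145 < m := by nlinarith
  have hbridge : bridge m [] 1 = Set.Icc m (6 * m) := by
    rw [bridge, prepend, prepend, Nat.cast_one, inv_six_add hm', inv_one_add hm',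
      Set.uIcc_of_ge (by linarith)]
  have hgap : bridgeGap m [] 1 ≤ bridgeLength m [] 1 := by
    have h4 : bridgeLength m [] 1 = 5 * m := by
      rw [bridgeLength, prepend, prepend, Nat.cast_one, inv_six_add hm', inv_one_add hm',
        abs_of_pos (by linarith)]
      ring
    have h5 : (1 + 1 + m)⁻¹ ≤ (2 : ℝ)⁻¹ := inv_anti₀ (by norm_num) (by linarith)
    have h6 : (1 + 6 * m)⁻¹ ≤ (1 : ℝ)⁻¹ := inv_anti₀ (by norm_num) (by linarith)
    have h7 : (3 : ℝ)⁻¹ ≤ (1 + 1 + m)⁻¹ := inv_anti₀ (by positivity) (by linarith)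
    have h8 : 0 ≤ (1 + 6 * m)⁻¹ := by positivity
    rw [h4, bridgeGap, prepend, prepend, Nat.cast_one, abs_le]
    constructor <;> linarith
  have hpair : BridgePair m s [] [] 1 1 := by
    refine ⟨by simp, by simp, le_rfl, by norm_num, le_rfl, by norm_num, ?_, hgap, hgap⟩
    rw [hbridge]
    exact ⟨s / 2, ⟨by linarith [hs.1], by linarith [hs.2]⟩, s / 2,
      ⟨by linarith [hs.1], by linarith [hs.2]⟩, by ring⟩
  obtain ⟨u, v, k, l, h, hu, hv⟩ := hpair.exists_length_ge hm hm' L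
  obtain ⟨x, hx, y, hy, rfl⟩ := h.exists_add
  obtain ⟨c, hc, hX⟩ := exists_word_of_mem_bridge hm h.left_mem h.one_le_left hu hx
  obtain ⟨d, hd, hY⟩ := exists_word_of_mem_bridge hm h.right_mem h.one_le_right hv hy
  refine ⟨c, d, hc, hd, fun X Y h1 h2 h3 h4 => ?_⟩
  have e : X 0 + Y 0 - (x + y) = (X 0 - x) + (Y 0 - y) := by ring
  rw [e]
  refine (abs_add_le _ _).trans ?_
  rw [show (2 : ℝ) / (L + 1) = 1 / (L + 1) + 1 / (L + 1) by ring]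
  exact add_le_add (hX X h1 h3) (hY Y h2 h4)

theorem revTail_pos {a : ℕ → ℕ} (ha : ∀ n, 1 ≤ a n) {n : ℕ} (hn : n ≠ 0) : 0 < revTail a n := by
  obtain ⟨n, rfl⟩ := Nat.exists_eq_succ_of_ne_zero hn
  have h1 : (1 : ℝ) ≤ a n := by exact_mod_cast ha n
  have h2 := revTail_nonneg a n
  rw [revTail]
  positivity

theorem zero_mem_L2 : (0 : ℝ) ∈ L2 := by
  obtain ⟨x, h⟩ := exists_cfExpansion (fun n => n + 1) fun n => by omega
  refine ⟨x 0, h.irrational, (h.kConst_eq (by norm_num) (fun ε hε => ?_) fun ε hε => ?_).symm⟩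
  · refine Eventually.of_forall fun n => ?_
    have := div_pos (by norm_num : (0 : ℝ) < 4) (h.cfSum_pos n)
    linarith
  · refine Eventually.frequently ?_
    filter_upwards [eventually_ge_atTop ⌈4 / ε⌉₊] with n hn
    have h1 : 4 / ε ≤ n := Nat.ceil_le.1 hn
    have h2 : (n : ℝ) ≤ cfSum (fun n => n + 1) x n := by
      rw [cfSum]
      push_cast
      linarith [h.pos (n + 1), revTail_nonneg (fun n => n + 1) n]
    rw [div_le_iff₀ hε] at h1
    rw [zero_add, div_le_iff₀ (h.cfSum_pos n)]
    nlinarith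

/-- The sequence with `A` at the perfect squares, where each square `k²` is followed by
`c k 0, c k 1, …` and preceded by `d k 0, d k 1, …` (read backwards). -/
def squareDigits (A : ℕ) (c d : ℕ → ℕ → ℕ) (n : ℕ) : ℕ :=
  if n = n.sqrt * n.sqrt then A
  else if n - n.sqrt * n.sqrt ≤ n.sqrt then c n.sqrt (n - n.sqrt * n.sqrt - 1)
  else d (n.sqrt + 1) (n.sqrt * n.sqrt + 2 * n.sqrt - n)

section

variable (A : ℕ) (c d : ℕ → ℕ → ℕ) {i k : ℕ}

theorem squareDigits_mul_self (k : ℕ) : squareDigits A c d (k * k) = A := by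
  simp [squareDigits, Nat.sqrt_eq]

theorem squareDigits_add (hi : i < k) : squareDigits A c d (k * k + 1 + i) = c k i := by
  have h : (k * k + 1 + i).sqrt = k := by rw [add_assoc, Nat.sqrt_add_eq k (by omega)]
  rw [squareDigits, h, if_neg (by omega), if_pos (by omega)]
  congr 1
  omega

theorem squareDigits_sub (hi : i < k) :
    squareDigits A c d ((k + 1) * (k + 1) - 1 - i) = d (k + 1) i := by
  have h0 : (k + 1) * (k + 1) - 1 - i = k * k + (2 * k - i) := by
    have : (k + 1) * (k + 1) = k * k + 2 * k + 1 := by ring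
    omega
  have h : (k * k + (2 * k - i)).sqrt = k := Nat.sqrt_add_eq k (by omega)
  rw [h0, squareDigits, h, if_neg (by omega), if_neg (by omega)]
  congr 1
  omega

theorem squareDigits_mem {A : ℕ} {c d : ℕ → ℕ → ℕ} (hc : ∀ k i, 1 ≤ c k i ∧ c k i ≤ 6)
    (hd : ∀ k i, 1 ≤ d k i ∧ d k i ≤ 6) {n : ℕ} (hn : n ≠ n.sqrt * n.sqrt) :
    1 ≤ squareDigits A c d n ∧ squareDigits A c d n ≤ 6 := by
  rw [squareDigits, if_neg hn]
  split_ifs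
  exacts [hc _ _, hd _ _]

end

theorem mem_L2_of_pos {l : ℝ} (hl0 : 0 < l) (hl : l ≤ 1 / 2) : l ∈ L2 := by
  set μ := 4 / l with hμ
  have hμ8 : 8 ≤ μ := by rw [hμ, le_div_iff₀ hl0]; linarith
  have hlμ : l = 4 / μ := by rw [hμ]; field_simp
  set A := ⌊μ - 1 / 2⌋₊ with hA
  have hA1 : (A : ℝ) ≤ μ - 1 / 2 := Nat.floor_le (by linarith)
  have hA2 : μ - 1 / 2 < A + 1 := Nat.lt_floor_add_one _
  have hA0 : 1 ≤ A := Nat.le_floor (by norm_num; linarith)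
  have hs : μ - A ∈ Set.Icc (1 / 2 : ℝ) (3 / 2) := ⟨by linarith, by linarith⟩
  choose c d hc hd hcd using fun k : ℕ => exists_digits_add hs (k - 1)
  set a := squareDigits A c d with ha
  have ha1 : ∀ n, 1 ≤ a n := by
    intro n
    by_cases hn : n = n.sqrt * n.sqrt
    · rw [hn, ha, squareDigits_mul_self]
      exact hA0
    · exact (squareDigits_mem hc hd hn).1
  obtain ⟨x, h⟩ := exists_cfExpansion a ha1
  have hbound : ∀ k : ℕ, |cfSum a x ((k + 1) * (k + 1)) - μ| ≤ 2 / (k + 1) := by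
    intro k
    have hk : k < (k + 1) * (k + 1) := by nlinarith
    have := hcd (k + 1) (fun i => x ((k + 1) * (k + 1) + 1 + i))
      (fun i => revTail a ((k + 1) * (k + 1) - i)) (fun i hi => ?_) (fun i hi => ?_)
      ⟨h.pos _, (h.lt_one _).le⟩ ⟨revTail_pos ha1 ?_, h.revTail_le_one _⟩
    · rw [Nat.add_sub_cancel] at this
      have e : cfSum a x ((k + 1) * (k + 1)) - μ = x ((k + 1) * (k + 1) + 1 + 0)
          + revTail a ((k + 1) * (k + 1) - 0) - (μ - A) := by
        rw [cfSum, ha, squareDigits_mul_self, add_zero, Nat.sub_zero]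
        ring
      rw [e]
      exact this
    · rw [h.eq_inv, ha, squareDigits_add A c d (by omega), ← add_assoc]
    · have e : (k + 1) * (k + 1) - i = (k + 1) * (k + 1) - (i + 1) + 1 := by omega
      rw [e, revTail, ha, ← squareDigits_sub A c d (show i < k by omega), add_comm i 1,
        ← Nat.sub_sub]
    · rw [Nat.add_sub_cancel]
      omega
  have hlim : Tendsto (fun k : ℕ => 4 / cfSum a x ((k + 1) * (k + 1))) atTop (nhds l) := by
    have h1 : Tendsto (fun k : ℕ => (2 : ℝ) / (k + 1)) atTop (nhds 0) := by
      simpa [div_eq_mul_inv] using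
        (tendsto_one_div_add_atTop_nhds_zero_nat (𝕜 := ℝ)).const_mul 2
    have h2 : Tendsto (fun k : ℕ => cfSum a x ((k + 1) * (k + 1))) atTop (nhds μ) :=
      tendsto_iff_norm_sub_tendsto_zero.2
        (squeeze_zero (fun _ => norm_nonneg _) hbound h1)
    rw [hlμ]
    exact tendsto_const_nhds.div h2 (by positivity)
  refine ⟨x 0, h.irrational, (h.kConst_eq hl (fun ε hε => ?_) fun ε hε => ?_).symm⟩
  · obtain ⟨K, hK⟩ := eventually_atTop.1 (hlim.eventually_const_le (show l - ε < l by linarith))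
    filter_upwards [eventually_ge_atTop ((K + 1) * (K + 1))] with n hn
    by_cases hn' : n = n.sqrt * n.sqrt
    · have h1 : K + 1 ≤ n.sqrt := Nat.le_sqrt.2 hn
      have h2 := hK (n.sqrt - 1) (by omega)
      rwa [Nat.sub_add_cancel (by omega), ← hn'] at h2
    · have h1 : cfSum a x n ≤ μ := by
        have h6 : (a n : ℝ) ≤ 6 := by exact_mod_cast (squareDigits_mem hc hd hn').2
        rw [cfSum]
        linarith [h.lt_one (n + 1), h.revTail_le_one n]
      have h2 : l ≤ 4 / cfSum a x n := by
        rw [hlμ]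
        exact div_le_div_of_nonneg_left (by norm_num) (h.cfSum_pos n) h1
      linarith
  · have h1 : Tendsto (fun k : ℕ => (k + 1) * (k + 1)) atTop atTop :=
      tendsto_atTop_mono (fun k => by rw [id]; nlinarith) tendsto_id
    exact h1.frequently
      (hlim.eventually_le_const (show l < l + ε by linarith)).frequently

/-- The whole segment `[0, 12/(21+√15)]` is contained in the spectrum `𝕃₂`. -/
theorem stmt_4 :
    Set.Icc (0 : ℝ) (12 / (21 + Real.sqrt 15)) ⊆ L2 := by
  rintro l ⟨hl0, hl⟩
  rcases hl0.eq_or_lt with rfl | hl0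
  · exact zero_mem_L2
  · refine mem_L2_of_pos hl0 (hl.trans ?_)
    have : 3 ≤ Real.sqrt 15 := Real.le_sqrt_of_sq_le (by norm_num)
    rw [div_le_div_iff₀ (by positivity) (by norm_num)]
    linarith
end
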